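/- arXiv:2204.07345 — 2 statements merged into one kernel-verified Lean document; each statement's English description precedes it below -/
import Mathlib

section
/- Let n ≥ 3 be odd. A sequence S in Z_n is a U(n)-extremal sequence for the Gao constant if and only if S is U(n)-equivalent to a sequence of the form (b_1, p_1 b_2, p_1 p_2 b_3, …, p_1 p_2 ⋯ p_{k−1} b_k, 0, …, 0), where n = p_1 p_2 ⋯ p_k is a factorization of n into primes, each b_i is coprime to p_i, and 0 occurs n − 1 times. -/
open Classical in
/-- The number of terms of the sequence `S` satisfying the predicate `P`. -/
noncomputable def pcount {α : Type*} (P : α → Prop) (S : List α) : ℕ :=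
  S.countP fun x => decide (P x)

/-- `S` is an `A`-weighted zero-sum sequence in `ZMod n`: there are weights
`a i ∈ A` with `∑ a i * x i = 0`. -/
def IsWZSum {n : ℕ} (A : Set (ZMod n)) (S : List (ZMod n)) : Prop :=
  ∃ w : List (ZMod n), w.length = S.length ∧ (∀ a ∈ w, a ∈ A) ∧
    (List.zipWith (· * ·) w S).sum = 0

/-- `S` has an `A`-weighted zero-sum subsequence of length `t ≥ 1`. -/
def HasWZSS {n : ℕ} (A : Set (ZMod n)) (S : List (ZMod n)) (t : ℕ) : Prop :=
  0 < t ∧ ∃ T : List (ZMod n), T.Sublist S ∧ T.length = t ∧ IsWZSum A T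

/-- `S` has a nonempty `A`-weighted zero-sum subsequence. -/
def HasWZS {n : ℕ} (A : Set (ZMod n)) (S : List (ZMod n)) : Prop :=
  ∃ T : List (ZMod n), T.Sublist S ∧ T ≠ [] ∧ IsWZSum A T

/-- The `A`-weighted Davenport constant `D_A(n)`: the least `k > 0` such that every
sequence of length `k` in `ZMod n` has a nonempty `A`-weighted zero-sum subsequence. -/
noncomputable def DavC (n : ℕ) (A : Set (ZMod n)) : ℕ :=
  sInf {k | 0 < k ∧ ∀ S : List (ZMod n), S.length = k → HasWZS A S}

/-- The `A`-weighted Gao constant `E_A(n)`: the least `k > 0` such that every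
sequence of length `k` in `ZMod n` has an `A`-weighted zero-sum subsequence of length `n`. -/
noncomputable def GaoC (n : ℕ) (A : Set (ZMod n)) : ℕ :=
  sInf {k | 0 < k ∧ ∀ S : List (ZMod n), S.length = k → HasWZSS A S n}

/-- The set of units of `ZMod n`. -/
def U (n : ℕ) : Set (ZMod n) := {x | IsUnit x}

/-- An `A`-extremal sequence for the Gao constant: a sequence of length `E_A(n) - 1`
with no `A`-weighted zero-sum subsequence of length `n`. -/
def IsGaoExtremal (n : ℕ) (A : Set (ZMod n)) (S : List (ZMod n)) : Prop :=
  S.length = GaoC n A - 1 ∧ ¬ HasWZSS A S n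

/-- `S` and `T` are `A`-equivalent: there are a unit `c`, weights `a i ∈ A` and a
permutation matching the multiset of terms `c * y j` with the multiset `a i * x i`. -/
def AEquiv {n : ℕ} (A : Set (ZMod n)) (S T : List (ZMod n)) : Prop :=
  ∃ c : ZMod n, IsUnit c ∧ ∃ w : List (ZMod n), w.length = S.length ∧
    (∀ a ∈ w, a ∈ A) ∧ (T.map fun y => c * y).Perm (List.zipWith (· * ·) w S)

/-- If every prime dividing the odd number `m` fails to divide at least two of the terms `t i`,
then some combination of the `t i` with coefficients coprime to `m` vanishes modulo `m`. -/
theorem exists_coprime_weights_dvd_sum {ι : Type*} (I : Finset ι) (t : ι → ℤ) (m : ℕ)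
    (hm : Odd m)
    (h : ∀ p : ℕ, p.Prime → p ∣ m →
      ∃ i ∈ I, ∃ j ∈ I, i ≠ j ∧ ¬ (p : ℤ) ∣ t i ∧ ¬ (p : ℤ) ∣ t j) :
    ∃ w : ι → ℤ, (∀ i, IsCoprime (w i) (m : ℤ)) ∧ (m : ℤ) ∣ ∑ i ∈ I, w i * t i := by
  classical
  induction m using Nat.recOnPosPrimePosCoprime with
  | zero => simp at hm
  | one => exact ⟨fun _ => 1, fun _ => isCoprime_one_left, by simp⟩
  | prime_pow p r hp hr =>
    obtain ⟨i, hi, j, hj, hij, hti, htj⟩ := h p hp (dvd_pow_self p hr.ne')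
    have hpZ : Prime (p : ℤ) := Nat.prime_iff_prime_int.mp hp
    have hp2 : ¬ (p : ℤ) ∣ 2 := by
      intro h2
      have : p ∣ 2 := by exact_mod_cast h2
      have hp2 : p = 2 := (Nat.prime_dvd_prime_iff_eq hp Nat.prime_two).mp this
      subst hp2
      exact absurd hm (by simp [Nat.even_pow, hr.ne'])
    set c : ℤ := ∑ l ∈ (I.erase j).erase i, t l
    obtain ⟨u, hu, hcu⟩ : ∃ u : ℤ, (u = 1 ∨ u = -1) ∧ ¬ (p : ℤ) ∣ c + u * t i := by
      by_contra! hcon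
      have h1 := hcon 1 (Or.inl rfl)
      have h2 := hcon (-1) (Or.inr rfl)
      have h3 : (p : ℤ) ∣ 2 * t i := by
        have := dvd_sub h1 h2
        ring_nf at this ⊢
        exact this
      exact (hpZ.dvd_or_dvd h3).elim hp2 hti
    have hcop : ∀ z : ℤ, ¬ (p : ℤ) ∣ z → IsCoprime z ((p ^ r : ℕ) : ℤ) := fun z hz => by
      push_cast
      exact ((hpZ.coprime_iff_not_dvd.mpr hz).symm).pow_right
    obtain ⟨a, b, hab⟩ := hcop _ htj
    refine ⟨fun l => if l = j then -(c + u * t i) * a else if l = i then u else 1,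
      fun l => ?_, ?_⟩
    · dsimp only
      split_ifs
      · exact ((hcop _ hcu).neg_left).mul_left ⟨t j, b, by linarith⟩
      · rcases hu with rfl | rfl
        · exact isCoprime_one_left
        · exact isCoprime_one_left.neg_left
      · exact isCoprime_one_left
    · have hi' : i ∈ I.erase j := Finset.mem_erase.mpr ⟨hij, hi⟩
      rw [← Finset.add_sum_erase _ _ hj, ← Finset.add_sum_erase _ _ hi']
      have hrest : ∑ l ∈ (I.erase j).erase i,
          (if l = j then -(c + u * t i) * a else if l = i then u else 1) * t l = c := by
        refine Finset.sum_congr rfl fun l hl => ?_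
        simp only [Finset.mem_erase] at hl
        rw [if_neg hl.2.1, if_neg hl.1, one_mul]
      rw [hrest]
      simp only [if_true, if_neg hij]
      exact ⟨(c + u * t i) * b, by linear_combination (-(c + u * t i)) * hab⟩
  | coprime a b ha hb hab iha ihb =>
    rw [Nat.odd_mul] at hm
    obtain ⟨wa, hwa, hsa⟩ := iha hm.1 fun p hp hpa => h p hp (hpa.mul_right b)
    obtain ⟨wb, hwb, hsb⟩ := ihb hm.2 fun p hp hpb => h p hp (hpb.mul_left a)
    have habZ : IsCoprime (a : ℤ) (b : ℤ) := Nat.isCoprime_iff_coprime.mpr hab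
    obtain ⟨u, v, huv⟩ := id habZ
    have hA : ∀ i, wb i * (u * a) + wa i * (v * b) = wa i + a * (u * (wb i - wa i)) :=
      fun i => by linear_combination (wa i) * huv
    have hB : ∀ i, wb i * (u * a) + wa i * (v * b) = wb i + b * (v * (wa i - wb i)) :=
      fun i => by linear_combination (wb i) * huv
    refine ⟨fun i => wb i * (u * a) + wa i * (v * b), fun i => ?_, ?_⟩
    · push_cast
      refine IsCoprime.mul_right ?_ ?_
      · rw [hA]
        exact (hwa i).add_mul_left_left _
      · rw [hB]
        exact (hwb i).add_mul_left_left _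
    · push_cast
      refine habZ.mul_dvd ?_ ?_
      · simp only [hA, add_mul, Finset.sum_add_distrib]
        exact dvd_add hsa (Finset.dvd_sum fun i _ => ⟨u * (wb i - wa i) * t i, by ring⟩)
      · simp only [hB, add_mul, Finset.sum_add_distrib]
        exact dvd_add hsb (Finset.dvd_sum fun i _ => ⟨v * (wa i - wb i) * t i, by ring⟩)

/-- A coprime residue modulo a divisor `m` of `n` lifts to a unit of `ZMod n`. -/
theorem exists_isUnit_intCast_sub {n m : ℕ} [NeZero n] (hmn : m ∣ n) (w : ℤ)
    (hw : IsCoprime w (m : ℤ)) :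
    ∃ z : ℤ, IsUnit (z : ZMod n) ∧ (m : ℤ) ∣ z - w := by
  have hu : IsUnit (w : ZMod m) := by
    obtain ⟨a, b, hab⟩ := hw
    refine IsUnit.of_mul_eq_one (a : ZMod m) ?_
    have := congrArg (Int.cast : ℤ → ZMod m) hab
    push_cast at this
    simpa [mul_comm] using this
  obtain ⟨v, hv⟩ := ZMod.unitsMap_surjective hmn hu.unit
  refine ⟨((v : ZMod n).val : ℤ), by simp, ?_⟩
  rw [← ZMod.intCast_eq_intCast_iff_dvd_sub]
  have := congrArg Units.val hv
  rw [ZMod.unitsMap_val] at this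
  simp only [IsUnit.unit_spec] at this
  rw [← this]
  rw [ZMod.cast_eq_val, Int.cast_natCast]

theorem two_mul_card_primeFactors_le {m : ℕ} (hm : Odd m) : m.primeFactors.card * 2 ≤ m := by
  have hpow : ∀ k : ℕ, k * 2 ≤ 3 ^ k := fun k => by
    induction k with
    | zero => simp
    | succ k ih =>
      have := Nat.one_le_pow k 3 (by norm_num)
      rw [pow_succ]
      omega
  calc m.primeFactors.card * 2 ≤ 3 ^ m.primeFactors.card := hpow _
    _ ≤ ∏ p ∈ m.primeFactors, p := by
      refine Finset.pow_card_le_prod _ _ _ fun p hp => ?_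
      have hp' := Nat.prime_of_mem_primeFactors hp
      have hodd : Odd p := hm.of_dvd_nat (Nat.dvd_of_mem_primeFactors hp)
      rcases hp'.two_le.eq_or_lt with h | h
      · subst h
        exact absurd hodd (by decide)
      · exact h
    _ ≤ m := Nat.le_of_dvd hm.pos (Nat.prod_primeFactors_dvd m)

theorem natCast_dvd_intCast_iff {n m : ℕ} (hmn : m ∣ n) (z : ℤ) :
    (m : ZMod n) ∣ (z : ZMod n) ↔ (m : ℤ) ∣ z := by
  constructor
  · rintro ⟨y, hy⟩
    obtain ⟨y, rfl⟩ := ZMod.intCast_surjective y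
    have h : ((z : ℤ) : ZMod n) = ((m * y : ℤ) : ZMod n) := by
      push_cast
      exact hy
    rw [ZMod.intCast_eq_intCast_iff_dvd_sub] at h
    have h2 : (m : ℤ) ∣ m * y - z := (Int.natCast_dvd_natCast.mpr hmn).trans h
    exact (dvd_sub_right (dvd_mul_right _ _)).mp h2
  · rintro ⟨y, rfl⟩
    exact ⟨(y : ZMod n), by push_cast; rfl⟩

/-- A zero-sum supported on a set of indices yields a zero-sum subsequence. -/
theorem hasWZSS_of_finset {n t : ℕ} {A : Set (ZMod n)} {S : List (ZMod n)} (ht : 0 < t)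
    (I : Finset (Fin S.length)) (hI : I.card = t) (w : Fin S.length → ZMod n)
    (hw : ∀ i, w i ∈ A) (hsum : ∑ i ∈ I, w i * S[i] = 0) : HasWZSS A S t := by
  refine ⟨ht, (I.sort (· ≤ ·)).map (fun i => S[i]),
    List.map_getElem_sublist (Finset.sortedLT_sort I).pairwise, by simp [hI],
    (I.sort (· ≤ ·)).map w, by simp, ?_, ?_⟩
  · intro a ha
    obtain ⟨i, -, rfl⟩ := List.mem_map.mp ha
    exact hw i
  · rw [List.zipWith_map, List.zipWith_self, ← hsum, ← Finset.sum_map_toList]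
    exact ((Finset.sort_perm_toList I (· ≤ ·)).map _).sum_eq

/-- If all terms of `S` are multiples of a divisor `d` of `n = d * m`, and for each prime `p ∣ m`
at least two terms are not multiples of `d * p`, then `S` has a unit-weighted zero-sum
subsequence of length `n`, provided that it has at least `n` terms. -/
theorem hasWZSS_of_forall_prime_not_pairwise {n d m : ℕ} (hodd : Odd n) (hdm : n = d * m)
    {S : List (ZMod n)} (hS : ∀ x ∈ S, (d : ZMod n) ∣ x) (hlen : n ≤ S.length)
    (h : ∀ p : ℕ, p.Prime → p ∣ m →
      ¬ S.Pairwise fun x y => ((d * p : ℕ) : ZMod n) ∣ x ∨ ((d * p : ℕ) : ZMod n) ∣ y) :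
    HasWZSS (U n) S n := by
  classical
  have hn : NeZero n := ⟨hodd.pos.ne'⟩
  have hmodd : Odd m := hodd.of_dvd_nat ⟨d, by rw [hdm, mul_comm]⟩
  have hmn : m ∣ n := ⟨d, by rw [hdm, mul_comm]⟩
  have hex : ∀ i : Fin S.length, ∃ z : ℤ, S[i] = (d : ZMod n) * (z : ZMod n) := fun i => by
    obtain ⟨y, hy⟩ := hS S[i] (List.getElem_mem _)
    obtain ⟨z, rfl⟩ := ZMod.intCast_surjective y
    exact ⟨z, hy⟩
  choose t ht using hex
  have hndvd : ∀ (p : ℕ) (i : Fin S.length), ¬ ((d * p : ℕ) : ZMod n) ∣ S[i] →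
      ¬ (p : ℤ) ∣ t i := by
    rintro p i hi ⟨y, hy⟩
    refine hi ⟨(y : ZMod n), ?_⟩
    rw [ht, hy]
    push_cast
    ring
  have hpair : ∀ p : ℕ, ∃ P : Finset (Fin S.length), P.card ≤ 2 ∧ (p.Prime → p ∣ m →
      ∃ i ∈ P, ∃ j ∈ P, i ≠ j ∧ ¬ (p : ℤ) ∣ t i ∧ ¬ (p : ℤ) ∣ t j) := fun p => by
    by_cases hp : p.Prime ∧ p ∣ m
    · have hp' := h p hp.1 hp.2
      rw [List.pairwise_iff_getElem] at hp'
      push Not at hp'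
      obtain ⟨i, j, hi, hj, hij, h1, h2⟩ := hp'
      refine ⟨{⟨i, hi⟩, ⟨j, hj⟩}, Finset.card_le_two, fun _ _ => ⟨⟨i, hi⟩, by simp, ⟨j, hj⟩,
        by simp, by simp [hij.ne], hndvd p ⟨i, hi⟩ h1, hndvd p ⟨j, hj⟩ h2⟩⟩
    · exact ⟨∅, by simp, fun h1 h2 => absurd ⟨h1, h2⟩ hp⟩
  choose P hPcard hP using hpair
  obtain ⟨I, hPI, -, hI⟩ := Finset.exists_subsuperset_card_eq (n := n)
    (Finset.subset_univ (m.primeFactors.biUnion P))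
    ((Finset.card_biUnion_le_card_mul _ _ 2 fun p _ => hPcard p).trans
      ((two_mul_card_primeFactors_le hmodd).trans (Nat.le_of_dvd hodd.pos hmn)))
    (by simpa using hlen)
  obtain ⟨w, hw, hsum⟩ := exists_coprime_weights_dvd_sum I t m hmodd fun p hp hpm => by
    obtain ⟨i, hi, j, hj, hij⟩ := hP p hp hpm
    have hsub : P p ⊆ I := (Finset.subset_biUnion_of_mem P
      (Nat.mem_primeFactors.mpr ⟨hp, hpm, hmodd.pos.ne'⟩)).trans hPI
    exact ⟨i, hsub hi, j, hsub hj, hij⟩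
  choose z hz hzw using fun i => exists_isUnit_intCast_sub hmn (w i) (hw i)
  refine hasWZSS_of_finset hodd.pos I hI (fun i => (z i : ZMod n)) hz ?_
  have hdvd : (m : ℤ) ∣ ∑ i ∈ I, z i * t i := by
    have : ∑ i ∈ I, z i * t i = ∑ i ∈ I, w i * t i + ∑ i ∈ I, (z i - w i) * t i := by
      rw [← Finset.sum_add_distrib]
      exact Finset.sum_congr rfl fun i _ => by ring
    rw [this]
    exact dvd_add hsum (Finset.dvd_sum fun i _ => (hzw i).mul_right _)
  have hcast : ∑ i ∈ I, (z i : ZMod n) * S[i] = ((d * ∑ i ∈ I, z i * t i : ℤ) : ZMod n) := by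
    push_cast
    rw [Finset.mul_sum]
    exact Finset.sum_congr rfl fun i _ => by rw [ht]; ring
  have hnZ : (n : ℤ) = d * m := by exact_mod_cast hdm
  rw [hcast, ZMod.intCast_zmod_eq_zero_iff_dvd, hnZ]
  exact mul_dvd_mul_left _ hdvd

/-- `IsStar n d S` says that `S` consists of terms `x₁, …, x_k` followed by `n - 1` zeros, where
`n = d * p₁ ⋯ p_k` with primes `p_i`, and each `x_i` is a multiple of `d * p₁ ⋯ p_{i-1}`
but not of `d * p₁ ⋯ p_i`. -/
inductive IsStar (n : ℕ) : ℕ → List (ZMod n) → Prop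
  | zeros : IsStar n n (List.replicate (n - 1) 0)
  | cons {d p : ℕ} {x : ZMod n} {S : List (ZMod n)} (hp : p.Prime) (hx : (d : ZMod n) ∣ x)
      (hxp : ¬ ((d * p : ℕ) : ZMod n) ∣ x) (hS : IsStar n (d * p) S) : IsStar n d (x :: S)

namespace IsStar

variable {n d : ℕ} {S : List (ZMod n)}

theorem dvd (h : IsStar n d S) : d ∣ n := by
  induction h with
  | zeros => exact dvd_rfl
  | cons _ _ _ _ ih => exact (dvd_mul_right _ _).trans ih

theorem forall_dvd (h : IsStar n d S) : ∀ x ∈ S, (d : ZMod n) ∣ x := by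
  induction h with
  | zeros =>
    intro x hx
    rw [List.eq_of_mem_replicate hx]
    exact dvd_zero _
  | @cons d p _ _ _ hx _ _ ih =>
    intro y hy
    rcases List.mem_cons.mp hy with rfl | hy
    · exact hx
    · exact (Dvd.intro (p : ZMod n) (by push_cast; rfl)).trans (ih y hy)

theorem length_eq (hn : 0 < n) (h : IsStar n d S) {m : ℕ} (hm : n = d * m) :
    S.length = ArithmeticFunction.cardFactors m + (n - 1) := by
  induction h generalizing m with
  | zeros =>
    have : m = 1 := Nat.eq_of_mul_eq_mul_left hn (by rw [← hm, mul_one])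
    simp [this]
  | @cons d p x S hp _ _ hS ih =>
    obtain ⟨q, hq⟩ := hS.dvd
    have hd : 0 < d := Nat.pos_of_ne_zero fun h0 => by simp [h0] at hm; omega
    have hmq : m = p * q := Nat.eq_of_mul_eq_mul_left hd (by rw [← hm, hq, mul_assoc])
    have hq0 : q ≠ 0 := by
      rintro rfl
      simp at hq
      omega
    rw [List.length_cons, ih hq, hmq, ArithmeticFunction.cardFactors_mul hp.ne_zero hq0,
      ArithmeticFunction.cardFactors_apply_prime hp]
    omega

theorem exists_of_eq_mul (hn : 0 < n) (m : ℕ) : ∀ d, n = d * m → ∃ S, IsStar n d S := by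
  induction m using Nat.strong_induction_on with
  | _ m ih =>
    intro d hm
    have hd : d ≠ 0 := by
      rintro rfl
      simp at hm
      omega
    rcases eq_or_ne m 1 with rfl | hm1
    · rw [mul_one] at hm
      subst hm
      exact ⟨_, zeros⟩
    · obtain ⟨p, hp, q, rfl⟩ := Nat.exists_prime_and_dvd hm1
      have hq : 0 < q := Nat.pos_of_ne_zero fun h0 => by simp [h0] at hm; omega
      have hm' : n = d * p * q := by rw [hm, mul_assoc]
      obtain ⟨S, hS⟩ := ih q (by nlinarith [hp.two_le]) (d * p) hm'
      refine ⟨(d : ZMod n) :: S, cons hp dvd_rfl (fun h => ?_) hS⟩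
      have h' : ((d * p : ℕ) : ZMod n) ∣ ((d : ℤ) : ZMod n) := by simpa using h
      rw [natCast_dvd_intCast_iff ⟨q, hm'⟩, Int.natCast_dvd_natCast] at h'
      have := Nat.le_of_dvd (Nat.pos_of_ne_zero hd) h'
      nlinarith [hp.two_le, Nat.pos_of_ne_zero hd]

theorem of_associated (h : IsStar n d S) {S' : List (ZMod n)}
    (hSS' : List.Forall₂ Associated S' S) : IsStar n d S' := by
  induction h generalizing S' with
  | zeros =>
    have : S' = List.replicate (n - 1) 0 := by
      refine List.eq_replicate_iff.mpr ⟨by simpa using hSS'.length_eq, fun x hx => ?_⟩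
      obtain ⟨i, hi, rfl⟩ := List.getElem_of_mem hx
      have := hSS'.get hi (by simpa [hSS'.length_eq] using hi)
      simpa using this
    rw [this]
    exact zeros
  | cons hp hx hxp _ ih =>
    rcases hSS' with _ | ⟨hab, hl⟩
    exact cons hp (hab.dvd_iff_dvd_right.mpr hx) (fun h => hxp (hab.dvd_iff_dvd_right.mp h)) (ih hl)

theorem length_lt_of_isWZSum (hn : 0 < n) (h : IsStar n d S) {T : List (ZMod n)}
    (hT : T.Sublist S) (hT0 : IsWZSum (U n) T) : T.length < n := by
  induction h generalizing T with
  | zeros =>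
    have := hT.length_le
    simp at this
    omega
  | @cons d p x S hp hx hxp hS ih =>
    rcases List.sublist_cons_iff.mp hT with hT | ⟨T', rfl, hT'⟩
    · exact ih hT hT0
    · exfalso
      obtain ⟨w, hlen, hw, hsum⟩ := hT0
      obtain _ | ⟨a, w⟩ := w
      · simp at hlen
      rw [List.zipWith_cons_cons, List.sum_cons] at hsum
      have hrest : ((d * p : ℕ) : ZMod n) ∣ (List.zipWith (· * ·) w T').sum := by
        refine List.dvd_sum fun y hy => ?_
        obtain ⟨i, hi, rfl⟩ := List.getElem_of_mem hy
        rw [List.getElem_zipWith]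
        exact (hS.forall_dvd _ (hT'.subset (List.getElem_mem _))).mul_left _
      have hax : ((d * p : ℕ) : ZMod n) ∣ a * x := by
        rw [eq_neg_of_add_eq_zero_left hsum]
        exact hrest.neg_right
      have ha : IsUnit a := hw a (by simp)
      exact hxp (ha.dvd_mul_left.mp hax)

end IsStar

theorem exists_weights_sum_eq_of_perm {n : ℕ} {A : Set (ZMod n)} {T T' : List (ZMod n)} (h : T.Perm T')
    {w : List (ZMod n)} (hlen : w.length = T.length) (hw : ∀ a ∈ w, a ∈ A) :
    ∃ w' : List (ZMod n), w'.length = T'.length ∧ (∀ a ∈ w', a ∈ A) ∧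
      (List.zipWith (· * ·) w' T').sum = (List.zipWith (· * ·) w T).sum := by
  induction h generalizing w with
  | nil => exact ⟨w, hlen, hw, rfl⟩
  | cons x _ ih =>
    obtain _ | ⟨a, w⟩ := w
    · simp at hlen
    obtain ⟨w', h1, h2, h3⟩ := ih (by simpa using hlen) fun b hb => hw b (List.mem_cons_of_mem _ hb)
    exact ⟨a :: w', by simp [h1], List.forall_mem_cons.mpr ⟨hw a (by simp), h2⟩, by simp [h3]⟩
  | swap x y l =>
    obtain _ | ⟨a, _ | ⟨b, w⟩⟩ := w
    · simp at hlen
    · simp at hlen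
    refine ⟨b :: a :: w, by simpa using hlen, fun c hc => hw c ?_, ?_⟩
    · simp only [List.mem_cons] at hc ⊢
      tauto
    · simp only [List.zipWith_cons_cons, List.sum_cons]
      ring
  | trans _ _ ih₁ ih₂ =>
    obtain ⟨w₁, h1, h2, h3⟩ := ih₁ hlen hw
    obtain ⟨w₂, h4, h5, h6⟩ := ih₂ h1 h2
    exact ⟨w₂, h4, h5, h6.trans h3⟩

theorem HasWZSS.perm {n t : ℕ} {A : Set (ZMod n)} {S S' : List (ZMod n)} (h : HasWZSS A S t)
    (hSS' : S.Perm S') : HasWZSS A S' t := by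
  obtain ⟨ht, T, hTS, hT, w, hlen, hw, hsum⟩ := h
  obtain ⟨T', hTT', hT'⟩ := List.exists_perm_sublist hTS hSS'
  obtain ⟨w', h1, h2, h3⟩ := exists_weights_sum_eq_of_perm hTT'.symm hlen hw
  exact ⟨ht, T', hT', hTT'.length_eq.trans hT, w', h1, h2, h3.trans hsum⟩

theorem HasWZSS.of_sublist {n t : ℕ} {A : Set (ZMod n)} {S S' : List (ZMod n)}
    (h : HasWZSS A S t) (hSS' : S.Sublist S') : HasWZSS A S' t := by
  obtain ⟨ht, T, hTS, hT⟩ := h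
  exact ⟨ht, T, hTS.trans hSS', hT⟩

theorem IsStar.not_hasWZSS {n d : ℕ} {S : List (ZMod n)} (hn : 0 < n) (h : IsStar n d S) :
    ¬ HasWZSS (U n) S n := by
  rintro ⟨-, T, hTS, hT, hT0⟩
  exact (h.length_lt_of_isWZSum hn hTS hT0).ne hT

/-- A sequence of multiples of `d`, where `n = d * m` is odd, without unit-weighted zero-sum
subsequence of length `n` has at most `Ω(m) + n - 1` terms, with equality only for rearrangements
of star sequences. -/
theorem hasWZSS_or_length_lt_or_isStar {n : ℕ} (hodd : Odd n) (m : ℕ) :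
    ∀ (d : ℕ) (S : List (ZMod n)), n = d * m → (∀ x ∈ S, (d : ZMod n) ∣ x) →
      HasWZSS (U n) S n ∨ S.length < ArithmeticFunction.cardFactors m + (n - 1) ∨
        (S.length = ArithmeticFunction.cardFactors m + (n - 1) ∧
          ∃ S', S.Perm S' ∧ IsStar n d S') := by
  classical
  have hn : 0 < n := hodd.pos
  induction m using Nat.strong_induction_on with
  | _ m ih =>
    intro d S hm hS
    by_cases hgood : n ≤ S.length ∧ ∀ p : ℕ, p.Prime → p ∣ m →
        ¬ S.Pairwise fun x y => ((d * p : ℕ) : ZMod n) ∣ x ∨ ((d * p : ℕ) : ZMod n) ∣ y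
    · exact Or.inl (hasWZSS_of_forall_prime_not_pairwise hodd hm hS hgood.1 hgood.2)
    rcases eq_or_ne m 1 with rfl | hm1
    · right
      have hlen : S.length < n := by
        by_contra! hlen
        exact hgood ⟨hlen, fun p hp hp1 => absurd (Nat.dvd_one.mp hp1) hp.ne_one⟩
      rw [mul_one] at hm
      subst hm
      rw [ArithmeticFunction.cardFactors_one, zero_add]
      rcases (Nat.le_sub_one_of_lt hlen).lt_or_eq with h | h
      · exact Or.inl h
      · refine Or.inr ⟨h, S, List.Perm.refl S, ?_⟩
        have : S = List.replicate (n - 1) 0 :=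
          List.eq_replicate_iff.mpr ⟨h, fun x hx => by simpa using hS x hx⟩
        rw [this]
        exact IsStar.zeros
    have hm0 : m ≠ 0 := by
      rintro rfl
      simp at hm
      omega
    by_cases hlen : n ≤ S.length
    swap
    · have := ArithmeticFunction.cardFactors_pos_iff_one_lt.mpr (show 1 < m by omega)
      exact Or.inr (Or.inl (by omega))
    obtain ⟨p, hp, ⟨q, rfl⟩, hpw⟩ : ∃ p : ℕ, p.Prime ∧ p ∣ m ∧
        S.Pairwise fun x y => ((d * p : ℕ) : ZMod n) ∣ x ∨ ((d * p : ℕ) : ZMod n) ∣ y := by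
      by_contra! hcon
      exact hgood ⟨hlen, hcon⟩
    have hq0 : q ≠ 0 := right_ne_zero_of_mul hm0
    have hqlt : q < p * q := by nlinarith [hp.two_le, Nat.pos_of_ne_zero hq0]
    have hmq : n = d * p * q := by rw [hm, mul_assoc]
    have hΩ : ArithmeticFunction.cardFactors (p * q) = 1 + ArithmeticFunction.cardFactors q := by
      rw [ArithmeticFunction.cardFactors_mul hp.ne_zero hq0,
        ArithmeticFunction.cardFactors_apply_prime hp]
    by_cases hall : ∀ x ∈ S, ((d * p : ℕ) : ZMod n) ∣ x
    · rcases ih q hqlt (d * p) S hmq hall with h | h | ⟨h, -⟩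
      · exact Or.inl h
      · exact Or.inr (Or.inl (by omega))
      · exact Or.inr (Or.inl (by omega))
    · push Not at hall
      obtain ⟨x, hx, hxp⟩ := hall
      have hperm := List.perm_cons_erase hx
      have hrest : ∀ y ∈ S.erase x, ((d * p : ℕ) : ZMod n) ∣ y := fun y hy =>
        ((List.pairwise_cons.mp ((hperm.pairwise_iff Or.symm).mp hpw)).1 y hy).resolve_left hxp
      have hlen' := hperm.length_eq
      rw [List.length_cons] at hlen'
      rcases ih q hqlt (d * p) (S.erase x) hmq hrest with h | h | ⟨h, S', hS', hstar⟩
      · exact Or.inl (h.of_sublist List.erase_sublist)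
      · exact Or.inr (Or.inl (by omega))
      · exact Or.inr (Or.inr ⟨by omega, x :: S', hperm.trans (hS'.cons x),
          IsStar.cons hp (hS x hx) hxp hstar⟩)

theorem gaoC_units_eq {n : ℕ} (hodd : Odd n) :
    GaoC n (U n) = ArithmeticFunction.cardFactors n + n := by
  have hn : 0 < n := hodd.pos
  refine le_antisymm (Nat.sInf_le ⟨by omega, fun S hS => ?_⟩)
    (le_csInf ⟨ArithmeticFunction.cardFactors n + n, by omega, fun S hS => ?_⟩ ?_)
  iterate 2
    rcases hasWZSS_or_length_lt_or_isStar hodd n 1 S (one_mul n).symm (by simp) with h | h | ⟨h, -⟩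
    · exact h
    · omega
    · omega
  rintro k ⟨-, hk⟩
  by_contra! hlt
  obtain ⟨S, hS⟩ := IsStar.exists_of_eq_mul hn n 1 (one_mul n).symm
  have hlen := hS.length_eq hn (one_mul n).symm
  refine hS.not_hasWZSS hn ((hk (S.take k) ?_).of_sublist (List.take_sublist k S))
  rw [List.length_take]
  omega

/-- The sequence `(d * b₁, d * p₁ * b₂, …, d * p₁ ⋯ p_{k-1} * b_k)` in `ZMod n`. -/
def starTerms (n : ℕ) (d : ℤ) {k : ℕ} (p : Fin k → ℕ) (b : Fin k → ℤ) : List (ZMod n) :=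
  List.ofFn fun i : Fin k => ((d * ((∏ j ∈ Finset.Iio i, (p j : ℤ)) * b i) : ℤ) : ZMod n)

theorem starTerms_succ (n : ℕ) (d : ℤ) {k : ℕ} (p : Fin (k + 1) → ℕ) (b : Fin (k + 1) → ℤ) :
    starTerms n d p b = ((d * b 0 : ℤ) : ZMod n) ::
      starTerms n (d * p 0) (fun i => p i.succ) (fun i => b i.succ) := by
  have hprod : ∀ i : Fin k, ∏ j ∈ Finset.Iio i.succ, (p j : ℤ) =
      p 0 * ∏ j ∈ Finset.Iio i, (p j.succ : ℤ) := fun i => by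
    have hIio : Finset.Iio i.succ = insert 0 ((Finset.Iio i).map (Fin.succEmb k)) := by
      rw [Fin.map_succEmb_Iio]
      ext j
      simp only [Finset.mem_Iio, Finset.mem_insert, Finset.mem_Ioo]
      rcases eq_or_ne j 0 with rfl | hj
      · simp
      · simp [hj, Fin.pos_iff_ne_zero]
    rw [hIio, Finset.prod_insert (by simp), Finset.prod_map]
    rfl
  have h0 : Finset.Iio (0 : Fin (k + 1)) = ∅ := by
    ext j
    simp
  rw [starTerms, List.ofFn_succ, starTerms]
  simp only [hprod, h0, Finset.prod_empty, one_mul, mul_assoc]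

theorem isStar_starTerms {n : ℕ} {k : ℕ} (p : Fin k → ℕ) (b : Fin k → ℤ) (d : ℕ)
    (hp : ∀ i, (p i).Prime) (hn : n = d * ∏ i, p i) (hb : ∀ i, IsCoprime (b i) (p i : ℤ))
    (hn0 : 0 < n) :
    IsStar n d (starTerms n d p b ++ List.replicate (n - 1) 0) := by
  induction k generalizing d with
  | zero =>
    have : d = n := by simpa using hn.symm
    subst this
    simpa [starTerms] using IsStar.zeros
  | succ k ih =>
    rw [Fin.prod_univ_succ, ← mul_assoc] at hn
    have hS := ih (fun i => p i.succ) (fun i => b i.succ) (d * p 0) (fun i => hp _) hn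
      fun i => hb _
    rw [starTerms_succ, List.cons_append]
    rw [Nat.cast_mul] at hS
    have hd : (d : ℤ) ≠ 0 := by
      rintro h
      rw [Int.natCast_eq_zero.mp h] at hn
      simp at hn
      omega
    refine IsStar.cons (hp 0) ⟨(b 0 : ZMod n), by push_cast; rfl⟩ (fun h => ?_) hS
    rw [natCast_dvd_intCast_iff ⟨_, hn⟩, Nat.cast_mul, mul_dvd_mul_iff_left hd] at h
    exact (Nat.prime_iff_prime_int.mp (hp 0)).not_isUnit ((hb 0).isUnit_of_dvd' h dvd_rfl)

theorem IsStar.exists_eq_starTerms {n d : ℕ} {S : List (ZMod n)} (h : IsStar n d S) :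
    ∃ (k : ℕ) (p : Fin k → ℕ) (b : Fin k → ℤ), (∀ i, (p i).Prime) ∧ n = d * ∏ i, p i ∧
      (∀ i, IsCoprime (b i) (p i : ℤ)) ∧ S = starTerms n d p b ++ List.replicate (n - 1) 0 := by
  induction h with
  | zeros => exact ⟨0, Fin.elim0, Fin.elim0, fun i => i.elim0, by simp, fun i => i.elim0,
      by simp [starTerms]⟩
  | @cons d q x S hq hx hxq _ ih =>
    obtain ⟨k, p, b, hp, hnp, hb, rfl⟩ := ih
    obtain ⟨y, rfl⟩ := hx
    obtain ⟨z, rfl⟩ := ZMod.intCast_surjective y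
    refine ⟨k + 1, Fin.cons q p, Fin.cons z b, Fin.cons hq hp, ?_, Fin.cons ?_ hb, ?_⟩
    · rw [Fin.prod_univ_succ, ← mul_assoc]
      simpa using hnp
    · refine ((Nat.prime_iff_prime_int.mp hq).coprime_iff_not_dvd.mpr ?_).symm
      rintro ⟨u, hu⟩
      refine hxq ⟨(u : ZMod n), ?_⟩
      simp only [Fin.cons_zero] at hu
      rw [hu]
      push_cast
      ring
    · rw [starTerms_succ]
      simp

theorem exists_perm_forall₂_associated_of_aEquiv {n : ℕ} {S T : List (ZMod n)}
    (h : AEquiv (U n) S T) : ∃ S', S.Perm S' ∧ List.Forall₂ Associated S' T := by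
  obtain ⟨c, hc, w, hlen, hw, hperm⟩ := h
  have h1 : List.Forall₂ Associated S (List.zipWith (· * ·) w S) := by
    refine List.forall₂_iff_get.mpr ⟨by simp [hlen], fun i h₁ h₂ => ?_⟩
    have hu : IsUnit (w[i]'(hlen ▸ h₁)) := hw _ (List.getElem_mem _)
    simp only [List.get_eq_getElem, List.getElem_zipWith]
    exact (associated_unit_mul_left _ _ hu).symm
  have h2 : Relation.Comp (List.Forall₂ Associated) List.Perm S (T.map fun y => c * y) :=
    ⟨_, h1, hperm.symm⟩
  rw [List.forall₂_comp_perm_eq_perm_comp_forall₂] at h2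
  obtain ⟨S', hS', h3⟩ := h2
  refine ⟨S', hS', (List.forall₂_map_right_iff.mp h3).imp fun x y hxy => ?_⟩
  exact hxy.trans (associated_unit_mul_left _ _ hc)

theorem aEquiv_of_perm {n : ℕ} {S T : List (ZMod n)} (h : S.Perm T) : AEquiv (U n) S T := by
  refine ⟨1, isUnit_one, List.replicate S.length 1, by simp, fun a ha => ?_, ?_⟩
  · rw [List.eq_of_mem_replicate ha]
    exact isUnit_one
  · have h1 : List.zipWith (· * ·) (List.replicate S.length 1) S = S :=
      List.ext_getElem (by simp) (by simp)
    rw [h1]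
    simpa using h.symm

/-- For odd `n ≥ 3`: a sequence in `ZMod n` is a `U(n)`-extremal sequence for the Gao
constant iff it is `U(n)`-equivalent to a sequence of the form
`(b 1, p 1 * b 2, ..., p 1 * ... * p (k-1) * b k, 0, ..., 0)` with `n - 1` zeroes, where
`n = p 1 * ... * p k` is a factorization into primes and each `b i` is coprime to `p i`. -/
theorem gao_extremal_iff_star_odd (n : ℕ) (hn : 3 ≤ n) (hodd : Odd n)
    (S : List (ZMod n)) :
    IsGaoExtremal n (U n) S ↔
      ∃ (k : ℕ) (p : Fin k → ℕ) (b : Fin k → ℤ),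
        (∀ i, (p i).Prime) ∧ n = ∏ i, p i ∧ (∀ i, IsCoprime (b i) ((p i : ℤ))) ∧
        AEquiv (U n) S
          ((List.ofFn fun i : Fin k =>
              (((∏ j ∈ Finset.Iio i, (p j : ℤ)) * b i : ℤ) : ZMod n)) ++
            List.replicate (n - 1) (0 : ZMod n)) := by
  have hn0 : 0 < n := hodd.pos
  have hform : ∀ {k : ℕ} (p : Fin k → ℕ) (b : Fin k → ℤ),
      (List.ofFn fun i : Fin k => (((∏ j ∈ Finset.Iio i, (p j : ℤ)) * b i : ℤ) : ZMod n)) =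
        starTerms n ((1 : ℕ) : ℤ) p b := fun p b => by
    simp only [starTerms, Nat.cast_one, one_mul]
  simp only [hform]
  rw [IsGaoExtremal, gaoC_units_eq hodd]
  constructor
  · rintro ⟨hlen, hS⟩
    rcases hasWZSS_or_length_lt_or_isStar hodd n 1 S (one_mul n).symm (by simp) with
      h | h | ⟨-, S', hSS', hstar⟩
    · exact absurd h hS
    · omega
    · obtain ⟨k, p, b, hp, hnp, hb, rfl⟩ := hstar.exists_eq_starTerms
      exact ⟨k, p, b, hp, by rwa [one_mul] at hnp, hb, aEquiv_of_perm hSS'⟩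
  · rintro ⟨k, p, b, hp, hnp, hb, hequiv⟩
    obtain ⟨S', hSS', hS'⟩ := exists_perm_forall₂_associated_of_aEquiv hequiv
    have hstar : IsStar n 1 S' :=
      (isStar_starTerms p b 1 hp (by rwa [one_mul]) hb hn0).of_associated hS'
    refine ⟨?_, fun h => hstar.not_hasWZSS hn0 (h.perm hSS')⟩
    rw [hSS'.length_eq, hstar.length_eq hn0 (one_mul n).symm]
    omega
end

section
/- Suppose n = 2 p_1 ⋯ p_k where the p_i are primes, let m be an odd positive integer with m ≤ n, and for 1 ≤ i ≤ k let b_i be an integer coprime to p_i. If k ≥ 2, let S = (b_1, p_1 b_2, p_1 p_2 b_3, …, p_1 ⋯ p_{k−1} b_k, n/2, …, n/2, 0, …, 0), where n/2 occurs m times and 0 occurs n − m times; if k = 1 and p_1 = p, let S = (b_1, p, …, p, 0, …, 0), where p occurs m times and 0 occurs n − m times. Then S is a U(n)-extremal sequence for the Gao constant; in particular S has length n − 1 + Ω(n) and has no U(n)-weighted zero-sum subsequence of length n. -/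
open Finset

/-- `x` restricted to `K` is a zero-sum sequence modulo `n` with weights coprime to `n`. -/
def UnitZeroSum {ι : Type*} (n : ℕ) (x : ι → ℕ) (K : Finset ι) : Prop :=
  ∃ w : ι → ℤ, (∀ i, IsCoprime (w i) (n : ℤ)) ∧ (n : ℤ) ∣ ∑ i ∈ K, w i * x i

lemma UnitZeroSum.of_prime_pow {ι : Type*} [DecidableEq ι] {p a : ℕ} {x : ι → ℕ}
    {K : Finset ι} {i : ι} (hi : i ∈ K) (hxi : IsCoprime (x i : ℤ) (p : ℤ)) (w : ι → ℤ)
    (hw : ∀ j, IsCoprime (w j) (p : ℤ))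
    (ht : IsCoprime (∑ j ∈ K.erase i, w j * x j) (p : ℤ)) :
    UnitZeroSum (p ^ a) x K := by
  obtain ⟨u, v, huv⟩ := hxi.pow_right (n := a)
  set t := ∑ j ∈ K.erase i, w j * x j with ht_def
  have hu : IsCoprime u ((p : ℤ) ^ a) := ⟨x i, v, by rw [← huv]; ring⟩
  refine ⟨Function.update w i (-t * u), fun j => ?_, ?_⟩
  · push_cast
    by_cases hj : j = i
    · subst hj
      simpa using ((ht.pow_right (n := a)).mul_left hu).neg_left
    · simpa [hj] using (hw j).pow_right
  · rw [← Finset.add_sum_erase _ _ hi]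
    have : ∑ j ∈ K.erase i, Function.update w i (-t * u) j * (x j : ℤ) = t := by
      refine Finset.sum_congr rfl fun j hj => ?_
      rw [Function.update_of_ne (Finset.ne_of_mem_erase hj)]
    rw [this, Function.update_self]
    exact ⟨t * v, by push_cast; linear_combination (-t) * huv⟩

lemma UnitZeroSum.mul_of_coprime {ι : Type*} {a b : ℕ} (hab : a.Coprime b) {x : ι → ℕ}
    {K : Finset ι} (ha : UnitZeroSum a x K) (hb : UnitZeroSum b x K) :
    UnitZeroSum (a * b) x K := by
  obtain ⟨w, hw, hwsum⟩ := ha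
  obtain ⟨z, hz, hzsum⟩ := hb
  have hab' := Nat.isCoprime_iff_coprime.mpr hab
  obtain ⟨u, v, huv⟩ := id hab'
  have hA : ∀ i, z i * u * a + w i * v * b = w i + a * ((z i - w i) * u) := fun i => by
    linear_combination (w i) * huv
  have hB : ∀ i, z i * u * a + w i * v * b = z i + b * ((w i - z i) * v) := fun i => by
    linear_combination (z i) * huv
  refine ⟨fun i => z i * u * a + w i * v * b, fun i => ?_, ?_⟩
  · push_cast
    refine IsCoprime.mul_right ?_ ?_
    · rw [hA]; exact (hw i).add_mul_left_left _
    · rw [hB]; exact (hz i).add_mul_left_left _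
  · push_cast
    refine hab'.mul_dvd ?_ ?_
    · simp_rw [hA, add_mul, Finset.sum_add_distrib, mul_assoc, ← Finset.mul_sum]
      exact dvd_add hwsum (dvd_mul_right _ _)
    · simp_rw [hB, add_mul, Finset.sum_add_distrib, mul_assoc, ← Finset.mul_sum]
      exact dvd_add hzsum (dvd_mul_right _ _)

lemma UnitZeroSum.mul_left {ι : Type*} {n d : ℕ} (hn : 0 < n) (hd : 0 < d) {x y : ι → ℕ}
    {K : Finset ι} (hxy : ∀ i ∈ K, x i = d * y i) (h : UnitZeroSum n y K) :
    UnitZeroSum (d * n) x K := by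
  obtain ⟨w, hw, hwsum⟩ := h
  have : NeZero (d * n) := ⟨(Nat.mul_pos hd hn).ne'⟩
  have lift : ∀ i, ∃ z : ℤ, IsCoprime z ((d * n : ℕ) : ℤ) ∧ (n : ℤ) ∣ z - w i := by
    intro i
    obtain ⟨u, hu⟩ := ZMod.unitsMap_surjective (Dvd.intro_left d rfl : n ∣ d * n)
      ((ZMod.coe_int_isUnit_iff_isCoprime (w i) n).mpr (hw i).symm).unit
    refine ⟨((u : ZMod (d * n)).val : ℤ), ?_, ?_⟩
    · exact ((ZMod.coe_int_isUnit_iff_isCoprime _ (d * n)).mp (by simp)).symm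
    · rw [← ZMod.intCast_zmod_eq_zero_iff_dvd]
      have := congrArg Units.val hu
      simp only [ZMod.unitsMap_val, IsUnit.unit_spec] at this
      push_cast
      rw [ZMod.natCast_val, this, sub_self]
  choose z hz hzw using lift
  refine ⟨z, hz, ?_⟩
  have : ∑ i ∈ K, z i * (x i : ℤ) = d * ∑ i ∈ K, z i * (y i : ℤ) := by
    rw [Finset.mul_sum]
    refine Finset.sum_congr rfl fun i hi => ?_
    rw [hxy i hi]; push_cast; ring
  rw [this]
  push_cast
  refine mul_dvd_mul_left _ ?_
  have key : ∑ i ∈ K, z i * (y i : ℤ) = ∑ i ∈ K, (z i - w i) * y i + ∑ i ∈ K, w i * y i := by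
    rw [← Finset.sum_add_distrib]
    exact Finset.sum_congr rfl fun i _ => by ring
  rw [key]
  exact dvd_add (Finset.dvd_sum fun i _ => (hzw i).mul_right _) hwsum

lemma isCoprime_intCast_of_not_dvd {p : ℕ} (hp : p.Prime) {a : ℤ} (h : ¬ (p : ℤ) ∣ a) :
    IsCoprime a (p : ℤ) :=
  ((Nat.prime_iff_prime_int.mp hp).irreducible.coprime_iff_not_dvd.mpr h).symm

/-- A sequence with at least two units modulo each odd prime factor of `n`, and with an even
nonzero number of odd terms when `n` is even, is a weighted zero-sum sequence. -/
lemma UnitZeroSum.of_two_le_card {ι : Type*} [DecidableEq ι] {n : ℕ} (hn : 0 < n) {x : ι → ℕ}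
    {K : Finset ι} (hodd : ∀ q, q.Prime → q ≠ 2 → q ∣ n → 2 ≤ #{i ∈ K | ¬ q ∣ x i})
    (htwo : 2 ∣ n → Even #{i ∈ K | ¬ 2 ∣ x i} ∧ 0 < #{i ∈ K | ¬ 2 ∣ x i}) :
    UnitZeroSum n x K := by
  induction n using Nat.recOnPosPrimePosCoprime with
  | zero => omega
  | one => exact ⟨1, fun i => by simp [isCoprime_one_left], by simp⟩
  | coprime a b ha hb hab iha ihb =>
    refine .mul_of_coprime hab
      (iha (by omega) (fun q h1 h2 h3 => hodd q h1 h2 (h3.mul_right b))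
        fun h => htwo (h.mul_right b))
      (ihb (by omega) (fun q h1 h2 h3 => hodd q h1 h2 (h3.mul_left a))
        fun h => htwo (h.mul_left a))
  | prime_pow p a hp ha =>
    have hcop : ∀ i, ¬ p ∣ x i → IsCoprime (x i : ℤ) (p : ℤ) := fun i hi =>
      isCoprime_intCast_of_not_dvd hp (by exact_mod_cast hi)
    by_cases hp2 : p = 2
    · subst hp2
      obtain ⟨heven, hpos⟩ := htwo (dvd_pow_self 2 ha.ne')
      obtain ⟨i, hi⟩ := Finset.card_pos.mp hpos
      obtain ⟨hiK, hi2⟩ := Finset.mem_filter.mp hi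
      refine .of_prime_pow hiK (hcop i hi2) 1 (fun j => by simp [isCoprime_one_left]) ?_
      refine isCoprime_intCast_of_not_dvd hp ?_
      have hall : Even (∑ j ∈ K, x j) := by
        rw [Finset.even_sum_iff_even_card_odd]
        simpa [← even_iff_two_dvd] using heven
      rw [← Finset.add_sum_erase _ _ hiK] at hall
      have : ¬ 2 ∣ ∑ j ∈ K.erase i, x j := by
        rw [even_iff_two_dvd] at hall; omega
      simpa using (by exact_mod_cast this : ¬ ((2 : ℕ) : ℤ) ∣ ((∑ j ∈ K.erase i, x j : ℕ) : ℤ))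
    · obtain ⟨i, hi, j, hj, hij⟩ := Finset.one_lt_card.mp (hodd p hp hp2 (dvd_pow_self p ha.ne'))
      obtain ⟨hiK, hip⟩ := Finset.mem_filter.mp hi
      obtain ⟨hjK, hjp⟩ := Finset.mem_filter.mp hj
      have hjE : j ∈ K.erase i := Finset.mem_erase.mpr ⟨hij.symm, hjK⟩
      set s : ℤ := ∑ l ∈ (K.erase i).erase j, (x l : ℤ) with hs
      have hc : ∃ c : ℤ, IsCoprime c (p : ℤ) ∧ ¬ (p : ℤ) ∣ c * x j + s := by
        by_cases h1 : (p : ℤ) ∣ 1 * x j + s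
        · refine ⟨2, ?_, fun h2 => hjp ?_⟩
          · have := (Nat.coprime_primes Nat.prime_two hp).mpr (Ne.symm hp2)
            exact_mod_cast Nat.isCoprime_iff_coprime.mpr this
          · have := dvd_sub h2 h1
            ring_nf at this
            exact_mod_cast this
        · exact ⟨1, isCoprime_one_left, h1⟩
      obtain ⟨c, hc, hcs⟩ := hc
      refine .of_prime_pow hiK (hcop i hip) (Function.update 1 j c) (fun l => ?_) ?_
      · by_cases hl : l = j
        · subst hl; simpa using hc
        · simp [hl, isCoprime_one_left]
      · refine isCoprime_intCast_of_not_dvd hp ?_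
        rw [← Finset.add_sum_erase _ _ hjE, Function.update_self]
        have : ∑ l ∈ (K.erase i).erase j, Function.update (1 : ι → ℤ) j c l * (x l : ℤ) = s := by
          refine Finset.sum_congr rfl fun l hl => ?_
          rw [Function.update_of_ne (Finset.ne_of_mem_erase hl)]; simp
        rwa [this]

lemma exists_subset_two_le_card_inter {ι : Type*} [DecidableEq ι] (P : Finset ℕ)
    (F : ℕ → Finset ι) (h : ∀ q ∈ P, 2 ≤ #(F q)) :
    ∃ W ⊆ P.biUnion F, #W ≤ 2 * #P ∧ ∀ q ∈ P, 2 ≤ #(W ∩ F q) := by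
  choose! T hTF hT using fun q hq => Finset.exists_subset_card_eq (h q hq)
  refine ⟨P.biUnion T, Finset.biUnion_mono hTF, ?_, fun q hq => ?_⟩
  · rw [mul_comm]
    exact Finset.card_biUnion_le_card_mul _ _ _ fun q hq => (hT q hq).le
  · rw [← hT q hq]
    exact Finset.card_le_card
      (Finset.subset_inter (Finset.subset_biUnion_of_mem T hq) (hTF q hq))

lemma exists_even_card_filter {ι : Type*} [DecidableEq ι] {X W : Finset ι} (c : ι → Prop)
    [DecidablePred c] {l : ℕ} (hWX : W ⊆ X) (hWl : #W < l) (hlX : l < #X) {a b : ι}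
    (ha : a ∈ X \ W) (hb : b ∈ X \ W) (hca : c a) (hcb : ¬ c b) :
    ∃ K, W ⊆ K ∧ K ⊆ X ∧ #K = l ∧ Even #(K.filter c) := by
  rw [Finset.mem_sdiff] at ha hb
  have hab : a ≠ b := fun h => hcb (h ▸ hca)
  have hcard : #((X.erase a).erase b) = #X - 2 := by
    rw [Finset.card_erase_of_mem (Finset.mem_erase.mpr ⟨hab.symm, hb.1⟩),
      Finset.card_erase_of_mem ha.1]; omega
  have hsub : W ⊆ (X.erase a).erase b := fun i hi => by
    simp only [Finset.mem_erase]
    exact ⟨fun h => hb.2 (h ▸ hi), fun h => ha.2 (h ▸ hi), hWX hi⟩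
  obtain ⟨K, hWK, hKX, hK⟩ := Finset.exists_subsuperset_card_eq hsub
    (show #W ≤ l - 1 by omega) (by omega)
  have haK : a ∉ K := fun h => by simpa using hKX h
  have hbK : b ∉ K := fun h => by simpa using hKX h
  have hKX' : K ⊆ X := hKX.trans ((Finset.erase_subset _ _).trans (Finset.erase_subset _ _))
  by_cases hev : Even #(K.filter c)
  · refine ⟨insert b K, hWK.trans (Finset.subset_insert _ _),
      Finset.insert_subset hb.1 hKX', ?_, ?_⟩
    · rw [Finset.card_insert_of_notMem hbK]; omega
    · rwa [Finset.filter_insert, if_neg hcb]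
  · refine ⟨insert a K, hWK.trans (Finset.subset_insert _ _),
      Finset.insert_subset ha.1 hKX', ?_, ?_⟩
    · rw [Finset.card_insert_of_notMem haK]; omega
    · rw [Finset.filter_insert, if_pos hca,
        Finset.card_insert_of_notMem (fun h => haK (Finset.mem_filter.mp h).1)]
      exact (Nat.not_even_iff_odd.mp hev).add_one

open ArithmeticFunction (cardFactors)

/-- The indices in `X` whose terms are not divisible by `d`. -/
def nonMultiples {ι : Type*} (X : Finset ι) (x : ι → ℕ) (d : ℕ) : Finset ι :=
  {i ∈ X | ¬ d ∣ x i}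

lemma mem_nonMultiples {ι : Type*} {X : Finset ι} {x : ι → ℕ} {d : ℕ} {i : ι} :
    i ∈ nonMultiples X x d ↔ i ∈ X ∧ ¬ d ∣ x i := by
  simp [nonMultiples]

lemma nonMultiples_subset {ι : Type*} (X : Finset ι) (x : ι → ℕ) (d : ℕ) :
    nonMultiples X x d ⊆ X := Finset.filter_subset _ _

lemma nonMultiples_mono {ι : Type*} (X : Finset ι) (x : ι → ℕ) {d e : ℕ} (h : d ∣ e) :
    nonMultiples X x d ⊆ nonMultiples X x e := fun i hi => by
  rw [mem_nonMultiples] at hi ⊢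
  exact ⟨hi.1, fun he => hi.2 (h.trans he)⟩

lemma nonMultiples_lcm {ι : Type*} [DecidableEq ι] (X : Finset ι) (x : ι → ℕ) (d e : ℕ) :
    nonMultiples X x (d.lcm e) = nonMultiples X x d ∪ nonMultiples X x e := by
  ext i
  simp only [Finset.mem_union, mem_nonMultiples, Nat.lcm_dvd_iff]
  tauto

/-- Dividing by `d` the terms of `X` that are multiples of `d`. -/
lemma nonMultiples_mul {ι : Type*} [DecidableEq ι] (X : Finset ι) (x : ι → ℕ) {d : ℕ}
    (hd : 0 < d) (e : ℕ) :
    nonMultiples X x (d * e) =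
      nonMultiples X x d ∪ nonMultiples (X \ nonMultiples X x d) (fun i => x i / d) e := by
  ext i
  simp only [Finset.mem_union, mem_nonMultiples, Finset.mem_sdiff]
  by_cases h : d ∣ x i
  · obtain ⟨y, hy⟩ := h
    simp [hy, Nat.mul_dvd_mul_iff_left hd, Nat.mul_div_cancel_left _ hd]
  · have : ¬ d * e ∣ x i := fun h' => h ((Dvd.intro e rfl).trans h')
    tauto

lemma card_nonMultiples_mul {ι : Type*} [DecidableEq ι] (X : Finset ι) (x : ι → ℕ) {d : ℕ}
    (hd : 0 < d) (e : ℕ) :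
    #(nonMultiples X x (d * e)) =
      #(nonMultiples X x d) +
        #(nonMultiples (X \ nonMultiples X x d) (fun i => x i / d) e) := by
  rw [nonMultiples_mul X x hd, Finset.card_union_of_disjoint]
  exact Finset.disjoint_sdiff.mono_right (nonMultiples_subset _ _ _)

/-- An odd nontrivial divisor `d` of `n` for which the number of non-multiples of `d` exceeds the
number of prime factors of `d` by exactly one. -/
def IsTight {ι : Type*} (n : ℕ) (X : Finset ι) (x : ι → ℕ) (d : ℕ) : Prop :=
  d ∣ n ∧ Odd d ∧ d ≠ 1 ∧ #(nonMultiples X x d) = cardFactors d + 1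

lemma IsTight.lcm {ι : Type*} [DecidableEq ι] {n : ℕ} (hn : 0 < n) {X : Finset ι} {x : ι → ℕ}
    (hall : ∀ d, d ∣ n → d ≠ 1 → cardFactors d < #(nonMultiples X x d)) {d e : ℕ}
    (hd : IsTight n X x d) (he : IsTight n X x e)
    (hde : (nonMultiples X x d ∩ nonMultiples X x e).Nonempty) :
    IsTight n X x (d.lcm e) := by
  obtain ⟨hdn, hd2, hd1, hdc⟩ := hd
  obtain ⟨hen, he2, he1, hec⟩ := he
  have hd0 : 0 < d := Nat.pos_of_dvd_of_pos hdn hn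
  have he0 : 0 < e := Nat.pos_of_dvd_of_pos hen hn
  have hl1 : d.lcm e ≠ 1 := fun h => hd1 (Nat.dvd_one.mp (h ▸ Nat.dvd_lcm_left d e))
  have hln : d.lcm e ∣ n := Nat.lcm_dvd hdn hen
  have hinter : cardFactors (d.gcd e) + 1 ≤ #(nonMultiples X x d ∩ nonMultiples X x e) := by
    by_cases hg : d.gcd e = 1
    · rw [hg, ArithmeticFunction.cardFactors_one]
      exact Finset.card_pos.mpr hde
    · refine (hall _ ((Nat.gcd_dvd_left d e).trans hdn) hg).trans_le (Finset.card_le_card ?_)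
      exact Finset.subset_inter (nonMultiples_mono X x (Nat.gcd_dvd_left d e))
        (nonMultiples_mono X x (Nat.gcd_dvd_right d e))
  have hfac : cardFactors (d.gcd e) + cardFactors (d.lcm e) = cardFactors d + cardFactors e := by
    rw [← ArithmeticFunction.cardFactors_mul (Nat.gcd_pos_of_pos_left e hd0).ne'
      (Nat.lcm_pos hd0 he0).ne', Nat.gcd_mul_lcm,
      ArithmeticFunction.cardFactors_mul hd0.ne' he0.ne']
  have hunion := Finset.card_union_add_card_inter (nonMultiples X x d) (nonMultiples X x e)
  have hlow := hall _ hln hl1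
  rw [nonMultiples_lcm] at hlow
  refine ⟨hln, (hd2.mul he2).of_dvd_nat (Nat.lcm_dvd_mul d e), hl1, ?_⟩
  rw [nonMultiples_lcm]
  omega

lemma exists_maximal_isTight_odd_card {ι : Type*} [DecidableEq ι] {n : ℕ} (hn : 0 < n)
    {X : Finset ι} {x : ι → ℕ}
    (hall : ∀ d, d ∣ n → d ≠ 1 → cardFactors d < #(nonMultiples X x d)) {M : Finset ι}
    (hM : Odd #M) (hcover : ∀ i ∈ M, ∃ d, IsTight n X x d ∧ i ∈ nonMultiples X x d) :
    ∃ d, IsTight n X x d ∧ (∀ e, IsTight n X x e → d ∣ e → e = d) ∧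
      Odd #(M ∩ nonMultiples X x d) := by
  classical
  set D : Finset ℕ := {d ∈ n.divisors | IsTight n X x d ∧ ∀ e, IsTight n X x e → d ∣ e → e = d}
    with hD
  have hunion : M = D.biUnion fun d => M ∩ nonMultiples X x d := by
    ext i
    simp only [Finset.mem_biUnion, Finset.mem_inter]
    refine ⟨fun hi => ?_, fun ⟨_, _, hi, _⟩ => hi⟩
    obtain ⟨d, hd, hid⟩ := hcover i hi
    obtain ⟨e, he, hmax⟩ := Finset.exists_max_image
      {e ∈ n.divisors | IsTight n X x e ∧ d ∣ e} id
      ⟨d, by simp [hd, hd.1, hn.ne']⟩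
    simp only [Finset.mem_filter, Nat.mem_divisors, id] at he hmax
    refine ⟨e, ?_, hi, nonMultiples_mono X x he.2.2 hid⟩
    simp only [hD, Finset.mem_filter, Nat.mem_divisors]
    refine ⟨he.1, he.2.1, fun e' he' hee' => ?_⟩
    exact le_antisymm (hmax e' ⟨⟨he'.1, hn.ne'⟩, he', he.2.2.trans hee'⟩)
      (Nat.le_of_dvd (Nat.pos_of_dvd_of_pos he'.1 hn) hee')
  have hdisj : (D : Set ℕ).PairwiseDisjoint fun d => M ∩ nonMultiples X x d := by
    intro d hd e he hne
    simp only [hD, Finset.coe_filter, Set.mem_ofPred_eq] at hd he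
    refine Finset.disjoint_left.mpr fun i hid hie => hne ?_
    have hl := IsTight.lcm hn hall hd.2.1 he.2.1
      ⟨i, Finset.mem_inter.mpr ⟨(Finset.mem_inter.mp hid).2, (Finset.mem_inter.mp hie).2⟩⟩
    rw [← hd.2.2 _ hl (Nat.dvd_lcm_left d e), he.2.2 _ hl (Nat.dvd_lcm_right d e)]
  rw [hunion, Finset.card_biUnion hdisj] at hM
  by_contra! hcon
  refine Nat.not_even_iff_odd.mpr hM (Finset.even_sum _ fun d hd => ?_)
  simp only [hD, Finset.mem_filter] at hd
  exact Nat.not_odd_iff_even.mp (hcon d hd.2.1 hd.2.2)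

/-- If one of the two parity classes of terms, `M`, is small and of even size, then it can be kept
entirely in a zero-sum subsequence of even length `l`. -/
lemma exists_unitZeroSum_of_even_card {ι : Type*} [DecidableEq ι] {n l : ℕ} (hn : 0 < n)
    (hl : Even l) {X M : Finset ι} {x : ι → ℕ} (hX : l ≤ #X)
    (hunits : ∀ q ∈ n.primeFactors.erase 2, 2 ≤ #(nonMultiples X x q))
    (hMcard : #M + 2 * #(n.primeFactors.erase 2) < l) (hM : Even #M)
    (hclass : M = nonMultiples X x 2 ∧ M.Nonempty ∨ M = X \ nonMultiples X x 2) :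
    ∃ K ⊆ X, #K = l ∧ UnitZeroSum n x K := by
  obtain ⟨W, hWX, hWcard, hW⟩ := exists_subset_two_le_card_inter _ _ hunits
  have hWX' : W ⊆ X := hWX.trans (Finset.biUnion_subset.mpr fun q _ => nonMultiples_subset _ _ _)
  have hMX : M ⊆ X := by
    rcases hclass with ⟨rfl, -⟩ | rfl
    exacts [nonMultiples_subset _ _ _, Finset.sdiff_subset]
  obtain ⟨K, hWK, hKX, hK⟩ := Finset.exists_subsuperset_card_eq (Finset.union_subset hMX hWX')
    ((Finset.card_union_le M W).trans (by omega)) hX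
  have hMK : M ⊆ K := Finset.subset_union_left.trans hWK
  refine ⟨K, hKX, hK, .of_two_le_card hn (fun q hq hq2 hqn => ?_) fun _ => ?_⟩
  · refine (hW q (by simp [hq, hq2, hqn, hn.ne'])).trans (Finset.card_le_card fun i hi => ?_)
    rw [Finset.mem_inter, mem_nonMultiples] at hi
    exact Finset.mem_filter.mpr ⟨hWK (Finset.mem_union_right _ hi.1), hi.2.2⟩
  · rcases hclass with ⟨hMO, hne⟩ | hME
    · have : {i ∈ K | ¬ 2 ∣ x i} = M := by
        ext i
        refine ⟨fun hi => ?_, fun hi => ?_⟩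
        · rw [Finset.mem_filter] at hi
          rw [hMO, mem_nonMultiples]; exact ⟨hKX hi.1, hi.2⟩
        · refine Finset.mem_filter.mpr ⟨hMK hi, ?_⟩
          rw [hMO, mem_nonMultiples] at hi; exact hi.2
      rw [this]; exact ⟨hM, hne.card_pos⟩
    · have : {i ∈ K | ¬ 2 ∣ x i} = K \ M := by
        ext i
        simp only [hME, Finset.mem_filter, Finset.mem_sdiff, mem_nonMultiples]
        have := @hKX i
        tauto
      rw [this, Finset.card_sdiff_of_subset hMK, hK]
      exact ⟨(Nat.even_sub (by omega)).mpr (by tauto), by omega⟩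

/-- Passing to the quotient by a divisor `d`, for the terms which are multiples of `d`. -/
lemma UnitZeroSum.of_div {ι : Type*} [DecidableEq ι] {n d : ℕ} (hn : 0 < n) (hdn : d ∣ n)
    {X K : Finset ι} {x : ι → ℕ} (hK : K ⊆ X \ nonMultiples X x d)
    (h : UnitZeroSum (n / d) (fun i => x i / d) K) : UnitZeroSum n x K := by
  have hd0 : 0 < d := Nat.pos_of_dvd_of_pos hdn hn
  have := UnitZeroSum.mul_left (x := x) (Nat.div_pos (Nat.le_of_dvd hn hdn) hd0) hd0
    (fun i hi => ?_) h
  · rwa [Nat.mul_div_cancel' hdn] at this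
  · have := Finset.mem_sdiff.mp (hK hi)
    rw [mem_nonMultiples] at this
    exact (Nat.mul_div_cancel' (by tauto)).symm

lemma card_primeFactors_erase_div_le {n d : ℕ} (hn : 0 < n) (hdn : d ∣ n) :
    #((n / d).primeFactors.erase 2) ≤ #(n.primeFactors.erase 2) :=
  Finset.card_le_card
    (Finset.erase_subset_erase _ (Nat.primeFactors_mono (Nat.div_dvd_of_dvd hdn) hn.ne'))

lemma cardFactors_div_add {n d : ℕ} (hn : 0 < n) (hdn : d ∣ n) :
    cardFactors (n / d) + cardFactors d = cardFactors n := by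
  have hd0 : 0 < d := Nat.pos_of_dvd_of_pos hdn hn
  rw [← ArithmeticFunction.cardFactors_mul (Nat.div_pos (Nat.le_of_dvd hn hdn) hd0).ne' hd0.ne',
    Nat.div_mul_cancel hdn]

/-- The case where one parity class `M` is small and of odd size, and each of its elements is
needed for some odd prime. -/
lemma exists_unitZeroSum_of_odd_card {ι : Type*} [DecidableEq ι] {n l : ℕ} (hn : 0 < n)
    (h2n : 2 ∣ n) (hl : Even l) {X M : Finset ι} {x : ι → ℕ} (hX : l + cardFactors n ≤ #X)
    (hall : ∀ d, d ∣ n → d ≠ 1 → cardFactors d < #(nonMultiples X x d))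
    (hMcard : #M + 2 * #(n.primeFactors.erase 2) < l) (hM : Odd #M)
    (hclass : M = nonMultiples X x 2 ∨ M = X \ nonMultiples X x 2)
    (hcover : ∀ i ∈ M, ∃ d, IsTight n X x d ∧ i ∈ nonMultiples X x d) :
    ∃ K ⊆ X, #K = l ∧ UnitZeroSum n x K := by
  obtain ⟨d, hd, hmax, hodd⟩ := exists_maximal_isTight_odd_card hn hall hM hcover
  obtain ⟨hdn, hd2, hd1, hdc⟩ := id hd
  have hd0 : 0 < d := Nat.pos_of_dvd_of_pos hdn hn
  have hcop : Nat.Coprime d 2 := hd2.coprime_two_right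
  have h2dn : d * 2 ∣ n := hcop.mul_dvd_of_dvd_of_dvd hdn h2n
  have h2d : 2 ∣ n / d := (Nat.dvd_div_iff_mul_dvd hdn).mpr h2dn
  have hn' : 0 < n / d := Nat.div_pos (Nat.le_of_dvd hn hdn) hd0
  have hω := card_primeFactors_erase_div_le hn hdn
  have hΩ := cardFactors_div_add hn hdn
  have hΩpos : 0 < cardFactors (n / d) :=
    ArithmeticFunction.cardFactors_pos_iff_one_lt.mpr (Nat.le_of_dvd hn' h2d)
  have hXcard := Finset.card_sdiff_add_card_eq_card (nonMultiples_subset X x d)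
  have hMsub : #(M \ nonMultiples X x d) ≤ #M := Finset.card_le_card Finset.sdiff_subset
  have hparity : nonMultiples (X \ nonMultiples X x d) (fun i => x i / d) 2 =
      nonMultiples X x 2 \ nonMultiples X x d := by
    ext i
    simp only [mem_nonMultiples, Finset.mem_sdiff]
    by_cases h : d ∣ x i
    · obtain ⟨y, hy⟩ := h
      simp [hy, Nat.mul_div_cancel_left _ hd0, Nat.Coprime.dvd_mul_left hcop.symm]
    · tauto
  suffices h : ∃ K ⊆ X \ nonMultiples X x d, #K = l ∧
      UnitZeroSum (n / d) (fun i => x i / d) K by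
    obtain ⟨K, hKX, hK, hsum⟩ := h
    exact ⟨K, hKX.trans Finset.sdiff_subset, hK, hsum.of_div hn hdn hKX⟩
  refine exists_unitZeroSum_of_even_card hn' hl (M := M \ nonMultiples X x d)
    (by omega) (fun q hq => ?_) (by omega) ?_ ?_
  · simp only [Finset.mem_erase, Nat.mem_primeFactors] at hq
    have hdq : d * q ∣ n := (Nat.dvd_div_iff_mul_dvd hdn).mp hq.2.2.1
    have hne : d * q ≠ 1 := fun h => hd1 (Nat.eq_one_of_mul_eq_one_right h)
    have hlow := hall _ hdq hne
    have hqΩ : cardFactors (d * q) = cardFactors d + 1 := by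
      rw [ArithmeticFunction.cardFactors_mul hd0.ne' hq.2.1.ne_zero,
        ArithmeticFunction.cardFactors_apply_prime hq.2.1]
    have hnt : #(nonMultiples X x (d * q)) ≠ cardFactors (d * q) + 1 := fun h => by
      have := hmax _ ⟨hdq, hd2.mul (hq.2.1.odd_of_ne_two hq.1), hne, h⟩ (Dvd.intro q rfl)
      exact hq.2.1.one_lt.ne' (Nat.eq_of_mul_eq_mul_left hd0 (by omega))
    have := card_nonMultiples_mul X x hd0 q
    omega
  · have := Finset.card_sdiff_add_card_inter M (nonMultiples X x d)
    rw [← this] at hM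
    grind
  · rw [hparity]
    rcases hclass with rfl | rfl
    · refine Or.inl ⟨rfl, ?_⟩
      by_contra hempty
      have hlow := hall _ h2dn (by omega)
      rw [card_nonMultiples_mul X x hd0, hparity, Finset.not_nonempty_iff_eq_empty.mp hempty,
        ArithmeticFunction.cardFactors_mul hd0.ne' two_ne_zero,
        ArithmeticFunction.cardFactors_apply_prime Nat.prime_two, hdc] at hlow
      simp at hlow
    · right
      ext i
      simp only [Finset.mem_sdiff]
      tauto

/-- The even case when one parity class of terms is small. -/
lemma exists_unitZeroSum_of_small_class {ι : Type*} [DecidableEq ι] {n l : ℕ} (hn : 0 < n)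
    (h2n : 2 ∣ n) (hl : Even l) (hnl : 4 * #(n.primeFactors.erase 2) + 2 ≤ l)
    {X M : Finset ι} {x : ι → ℕ} (hX : l + cardFactors n ≤ #X)
    (hall : ∀ d, d ∣ n → d ≠ 1 → cardFactors d < #(nonMultiples X x d))
    (hMcard : #M ≤ 2 * #(n.primeFactors.erase 2) + 1)
    (hclass : M = nonMultiples X x 2 ∨ M = X \ nonMultiples X x 2) :
    ∃ K ⊆ X, #K = l ∧ UnitZeroSum n x K := by
  have hunits : ∀ q, q.Prime → q ∣ n → 2 ≤ #(nonMultiples X x q) := fun q hq hqn => by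
    have := hall q hqn hq.ne_one
    rw [ArithmeticFunction.cardFactors_apply_prime hq] at this
    exact this
  have hO := hunits 2 Nat.prime_two h2n
  have hΩpos : 0 < cardFactors n :=
    ArithmeticFunction.cardFactors_pos_iff_one_lt.mpr (Nat.le_of_dvd hn h2n)
  by_cases hM : Even #M
  · refine exists_unitZeroSum_of_even_card hn hl (by omega) (fun q hq => ?_) (by omega) hM ?_
    · simp only [Finset.mem_erase, Nat.mem_primeFactors] at hq
      exact hunits q hq.2.1 hq.2.2.1
    · rcases hclass with rfl | h
      · exact Or.inl ⟨rfl, Finset.card_pos.mp (by omega)⟩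
      · exact Or.inr h
  by_cases hcover : ∀ i ∈ M, ∃ d, IsTight n X x d ∧ i ∈ nonMultiples X x d
  · exact exists_unitZeroSum_of_odd_card hn h2n hl hX hall (by omega)
      (Nat.not_even_iff_odd.mp hM) hclass hcover
  push Not at hcover
  obtain ⟨i, hiM, hi⟩ := hcover
  have hMX : M ⊆ X := by
    rcases hclass with rfl | rfl
    exacts [nonMultiples_subset _ _ _, Finset.sdiff_subset]
  obtain ⟨W, hWX, hWcard, hW⟩ := exists_subset_two_le_card_inter (n.primeFactors.erase 2)
    (fun q => (nonMultiples X x q).erase i) (fun q hq => by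
      simp only [Finset.mem_erase, Nat.mem_primeFactors] at hq
      by_cases hiq : i ∈ nonMultiples X x q
      · have h1 := hunits q hq.2.1 hq.2.2.1
        have h2 : #(nonMultiples X x q) ≠ 2 := fun h =>
          hi q ⟨hq.2.2.1, hq.2.1.odd_of_ne_two hq.1, hq.2.1.ne_one, by
            rw [h, ArithmeticFunction.cardFactors_apply_prime hq.2.1]⟩ hiq
        rw [Finset.card_erase_of_mem hiq]; omega
      · rw [Finset.erase_eq_of_notMem hiq]
        exact hunits q hq.2.1 hq.2.2.1)
  obtain ⟨o, ho, hoi⟩ := Finset.exists_mem_ne hO i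
  have hWX' : insert o W ⊆ X := Finset.insert_subset (nonMultiples_subset _ _ _ ho)
    (hWX.trans (Finset.biUnion_subset.mpr fun q _ =>
      (Finset.erase_subset _ _).trans (nonMultiples_subset _ _ _)))
  have hiW : i ∉ insert o W := by
    simp only [Finset.mem_insert, not_or]
    refine ⟨hoi.symm, fun h => ?_⟩
    have := hWX h
    simp at this
  have hWcard' : #(insert o W) ≤ 2 * #(n.primeFactors.erase 2) + 1 :=
    (Finset.card_insert_le _ _).trans (by omega)
  obtain ⟨j, hjX, hj⟩ : ∃ j ∈ X, j ∉ M ∪ insert o W := by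
    refine Finset.exists_mem_notMem_of_card_lt_card ?_
    exact (Finset.card_union_le _ _).trans_lt (by omega)
  simp only [Finset.mem_union, not_or] at hj
  have hiX := hMX hiM
  obtain ⟨K, hWK, hKX, hK, hev⟩ : ∃ K, insert o W ⊆ K ∧ K ⊆ X ∧ #K = l ∧
      Even #{i ∈ K | ¬ 2 ∣ x i} := by
    have hi' := Finset.mem_sdiff.mpr ⟨hiX, hiW⟩
    have hj' := Finset.mem_sdiff.mpr ⟨hjX, hj.2⟩
    rcases hclass with rfl | rfl
    · rw [mem_nonMultiples] at hiM hj
      exact exists_even_card_filter _ hWX' (by omega) (by omega) hi' hj' hiM.2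
        fun h => hj.1 ⟨hjX, h⟩
    · rw [Finset.mem_sdiff, mem_nonMultiples] at hiM hj
      exact exists_even_card_filter _ hWX' (by omega) (by omega) hj' hi' (by tauto) (by tauto)
  refine ⟨K, hKX, hK, .of_two_le_card hn (fun q hq hq2 hqn => ?_) fun _ => ⟨hev, ?_⟩⟩
  · refine (hW q (by simp [hq, hq2, hqn, hn.ne'])).trans (Finset.card_le_card fun t ht => ?_)
    rw [Finset.mem_inter, Finset.mem_erase, mem_nonMultiples] at ht
    exact Finset.mem_filter.mpr ⟨hWK (Finset.mem_insert_of_mem ht.1), ht.2.2.2⟩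
  · exact Finset.card_pos.mpr ⟨o, Finset.mem_filter.mpr
      ⟨hWK (Finset.mem_insert_self _ _), (mem_nonMultiples.mp ho).2⟩⟩

theorem exists_unitZeroSum {ι : Type*} [DecidableEq ι] {n l : ℕ} (hn : 0 < n) (hl : Even l)
    (hnl : 4 * #(n.primeFactors.erase 2) + 2 ≤ l) {X : Finset ι} {x : ι → ℕ}
    (hX : l + cardFactors n ≤ #X) :
    ∃ K ⊆ X, #K = l ∧ UnitZeroSum n x K := by
  induction n using Nat.strong_induction_on generalizing X x with
  | _ n ih =>
  by_cases hall : ∀ d, d ∣ n → d ≠ 1 → cardFactors d < #(nonMultiples X x d)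
  · have hunits : ∀ q, q.Prime → q ∣ n → 2 ≤ #(nonMultiples X x q) := fun q hq hqn => by
      have := hall q hqn hq.ne_one
      rw [ArithmeticFunction.cardFactors_apply_prime hq] at this
      exact this
    obtain ⟨W, hWX, hWcard, hW⟩ := exists_subset_two_le_card_inter (n.primeFactors.erase 2)
      (nonMultiples X x) (fun q hq => by
        simp only [Finset.mem_erase, Nat.mem_primeFactors] at hq
        exact hunits q hq.2.1 hq.2.2.1)
    have hWX' : W ⊆ X := hWX.trans (Finset.biUnion_subset.mpr fun q _ => nonMultiples_subset _ _ _)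
    have hodd : ∀ K, W ⊆ K → ∀ q, q.Prime → q ≠ 2 → q ∣ n → 2 ≤ #{i ∈ K | ¬ q ∣ x i} := by
      refine fun K hWK q hq hq2 hqn =>
        (hW q (by simp [hq, hq2, hqn, hn.ne'])).trans (Finset.card_le_card fun t ht => ?_)
      rw [Finset.mem_inter, mem_nonMultiples] at ht
      exact Finset.mem_filter.mpr ⟨hWK ht.1, ht.2.2⟩
    by_cases h2n : 2 ∣ n
    · have hΩpos : 0 < cardFactors n :=
        ArithmeticFunction.cardFactors_pos_iff_one_lt.mpr (Nat.le_of_dvd hn h2n)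
      obtain ⟨o, ho⟩ := Finset.card_pos.mp
        (show 0 < #(nonMultiples X x 2) from by have := hunits 2 Nat.prime_two h2n; omega)
      have hoX : insert o W ⊆ X := Finset.insert_subset (nonMultiples_subset _ _ _ ho) hWX'
      have hoW : #(insert o W) ≤ 2 * #(n.primeFactors.erase 2) + 1 :=
        (Finset.card_insert_le _ _).trans (by omega)
      by_cases hsub : nonMultiples X x 2 ⊆ insert o W
      · exact exists_unitZeroSum_of_small_class hn h2n hl hnl hX hall
          ((Finset.card_le_card hsub).trans hoW) (Or.inl rfl)
      by_cases hsub' : X \ nonMultiples X x 2 ⊆ insert o W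
      · exact exists_unitZeroSum_of_small_class hn h2n hl hnl hX hall
          ((Finset.card_le_card hsub').trans hoW) (Or.inr rfl)
      obtain ⟨a, ha, haW⟩ := Finset.not_subset.mp hsub
      obtain ⟨b, hb, hbW⟩ := Finset.not_subset.mp hsub'
      rw [mem_nonMultiples] at ha ho
      rw [Finset.mem_sdiff, mem_nonMultiples] at hb
      obtain ⟨K, hWK, hKX, hK, hev⟩ := exists_even_card_filter (fun i => ¬ 2 ∣ x i) hoX
        (show _ < l by omega) (by omega) (Finset.mem_sdiff.mpr ⟨ha.1, haW⟩)
        (Finset.mem_sdiff.mpr ⟨hb.1, hbW⟩) ha.2 (by tauto)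
      refine ⟨K, hKX, hK, .of_two_le_card hn
        (hodd K ((Finset.subset_insert _ _).trans hWK)) fun _ => ⟨hev, ?_⟩⟩
      exact Finset.card_pos.mpr ⟨o, Finset.mem_filter.mpr
        ⟨hWK (Finset.mem_insert_self _ _), ho.2⟩⟩
    · obtain ⟨K, hWK, hKX, hK⟩ := Finset.exists_subsuperset_card_eq hWX'
        (show #W ≤ l by omega) (by omega)
      exact ⟨K, hKX, hK, .of_two_le_card hn (hodd K hWK) fun h => absurd h h2n⟩
  · push Not at hall
    obtain ⟨d, hdn, hd1, hd⟩ := hall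
    have hd0 : 0 < d := Nat.pos_of_dvd_of_pos hdn hn
    have hω := card_primeFactors_erase_div_le hn hdn
    have hΩ := cardFactors_div_add hn hdn
    have hXcard := Finset.card_sdiff_add_card_eq_card (nonMultiples_subset X x d)
    obtain ⟨K, hKX, hK, hsum⟩ := ih (n / d) (Nat.div_lt_self hn (by omega))
      (Nat.div_pos (Nat.le_of_dvd hn hdn) hd0) (by omega)
      (X := X \ nonMultiples X x d) (x := fun i => x i / d) (by omega)
    exact ⟨K, hKX.trans Finset.sdiff_subset, hK, hsum.of_div hn hdn hKX⟩

lemma HasWZSS.of_unitZeroSum {n : ℕ} [NeZero n] {S : List (ZMod n)} {K : Finset (Fin S.length)}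
    (hK : #K = n) (h : UnitZeroSum n (fun i => (S.get i).val) K) : HasWZSS (U n) S n := by
  obtain ⟨w, hw, hsum⟩ := h
  set L := (List.finRange S.length).filter (· ∈ K) with hL
  have hnodup : L.Nodup := (List.nodup_finRange _).filter _
  have hLK : L.toFinset = K := by ext i; simp [hL]
  refine ⟨NeZero.pos n, L.map S.get, ?_, ?_, L.map fun i => ((w i : ℤ) : ZMod n), ?_, ?_, ?_⟩
  · conv_rhs => rw [← List.map_get_finRange S]
    exact List.filter_sublist.map _
  · rw [List.length_map, ← List.toFinset_card_of_nodup hnodup, hLK, hK]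
  · simp
  · intro a ha
    obtain ⟨i, -, rfl⟩ := List.mem_map.mp ha
    exact (ZMod.coe_int_isUnit_iff_isCoprime _ _).mpr (hw i).symm
  · rw [List.zipWith_map, List.zipWith_self, ← List.sum_toFinset _ hnodup, hLK]
    have := (ZMod.intCast_zmod_eq_zero_iff_dvd _ n).mpr hsum
    push_cast at this
    simpa only [ZMod.natCast_val, ZMod.cast_id', id] using this

lemma four_mul_card_primeFactors_add_two_le {n : ℕ} (hn : 0 < n) (h2n : 2 ∣ n) :
    4 * #(n.primeFactors.erase 2) + 2 ≤ n := by
  have h3 : 3 ^ #(n.primeFactors.erase 2) ≤ ∏ q ∈ n.primeFactors.erase 2, q := by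
    refine Finset.pow_card_le_prod _ _ _ fun q hq => ?_
    simp only [Finset.mem_erase, Nat.mem_primeFactors] at hq
    have := hq.2.1.two_le
    omega
  have hprod : 2 * ∏ q ∈ n.primeFactors.erase 2, q ≤ n := by
    have hmem : 2 ∈ n.primeFactors := by simp [Nat.prime_two, h2n, hn.ne']
    exact (Finset.mul_prod_erase _ (fun q => q) hmem).trans_le
      (Nat.le_of_dvd hn (Nat.prod_primeFactors_dvd n))
  have hbern : ∀ c : ℕ, 2 * c + 1 ≤ 3 ^ c := fun c => by
    induction c with
    | zero => simp
    | succ c ih => rw [pow_succ]; omega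
  have := hbern #(n.primeFactors.erase 2)
  omega

lemma hasWZSS_of_length_eq {n : ℕ} (hn : 0 < n) (h2n : 2 ∣ n) (S : List (ZMod n))
    (hS : S.length = n + cardFactors n) : HasWZSS (U n) S n := by
  have : NeZero n := ⟨hn.ne'⟩
  obtain ⟨K, -, hK, hsum⟩ := exists_unitZeroSum (X := Finset.univ)
    (x := fun i : Fin S.length => (S.get i).val) hn (even_iff_two_dvd.mpr h2n)
    (four_mul_card_primeFactors_add_two_le hn h2n) (by simp [hS])
  exact .of_unitZeroSum hK hsum

lemma HasWZSS.mono {n t : ℕ} {A : Set (ZMod n)} {S S' : List (ZMod n)} (h : S.Sublist S')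
    (hS : HasWZSS A S t) : HasWZSS A S' t := by
  obtain ⟨ht, T, hTS, hT⟩ := hS
  exact ⟨ht, T, hTS.trans h, hT⟩

lemma dvd_sum_zipWith_mul {R : Type*} [CommSemiring R] {g : R} {w S : List R}
    (h : ∀ a ∈ S, g ∣ a) : g ∣ (List.zipWith (· * ·) w S).sum := by
  induction S generalizing w with
  | nil => simp
  | cons a S ih =>
    cases w with
    | nil => simp
    | cons u w =>
      simp only [List.zipWith_cons_cons, List.sum_cons]
      exact dvd_add ((h a (by simp)).mul_left u) (ih fun b hb => h b (by simp [hb]))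

lemma not_isWZSum_cons {n : ℕ} {a g : ZMod n} {T : List (ZMod n)} (hT : ∀ c ∈ T, g ∣ c)
    (ha : ¬ g ∣ a) : ¬ IsWZSum (U n) (a :: T) := by
  rintro ⟨w, hlen, hw, hsum⟩
  match w with
  | [] => simp at hlen
  | u :: w =>
    simp only [List.zipWith_cons_cons, List.sum_cons] at hsum
    have hu : IsUnit u := hw u (by simp)
    have hdvd : g ∣ u * a :=
      (dvd_add_left (dvd_sum_zipWith_mul (w := w) hT)).mp (hsum ▸ dvd_zero g)
    exact ha (hu.dvd_mul_left.mp hdvd)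

lemma sum_zipWith_replicate {R : Type*} [CommSemiring R] (a : R) (m r : ℕ) {w : List R}
    (hw : w.length = m + r) :
    (List.zipWith (· * ·) w (List.replicate m a ++ List.replicate r 0)).sum =
      a * (w.take m).sum := by
  induction m generalizing w with
  | zero =>
    simpa using dvd_sum_zipWith_mul (g := (0 : R)) (w := w) (S := List.replicate r 0)
      fun b hb => by simp [List.eq_of_mem_replicate hb]
  | succ m ih =>
    match w with
    | [] => simp at hw; omega
    | u :: w =>
      simp only [List.length_cons] at hw
      simp only [List.replicate_succ, List.cons_append, List.zipWith_cons_cons, List.sum_cons,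
        List.take_succ_cons, ih (w := w) (by omega)]
      ring

lemma not_isWZSum_replicate {h m r : ℕ} (hh : 0 < h) (hm : Odd m) :
    ¬ IsWZSum (U (2 * h))
      (List.replicate m (h : ZMod (2 * h)) ++ List.replicate r (0 : ZMod (2 * h))) := by
  rintro ⟨w, hlen, hw, hsum⟩
  have : NeZero (2 * h) := ⟨by omega⟩
  rw [List.length_append, List.length_replicate, List.length_replicate] at hlen
  rw [sum_zipWith_replicate _ _ _ hlen] at hsum
  set s := (w.take m).sum with hs
  let φ := ZMod.castHom (Dvd.intro h rfl : 2 ∣ 2 * h) (ZMod 2)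
  have hφ : φ s = 1 := by
    have hone : ∀ a ∈ (w.take m).map φ, a = 1 := by
      intro a ha
      obtain ⟨u, hu, rfl⟩ := List.mem_map.mp ha
      have hunit : IsUnit (φ u) := (show IsUnit u from hw u (List.mem_of_mem_take hu)).map φ
      generalize φ u = z at hunit
      revert z
      decide
    rw [hs, map_list_sum, List.eq_replicate_of_mem hone, List.sum_replicate]
    simp only [List.length_map, List.length_take, nsmul_eq_mul, mul_one]
    rw [min_eq_left (by omega)]
    exact ZMod.natCast_eq_one_iff_odd.mpr hm
  have hφ' : φ s = 0 := by
    have hdvd : 2 * h ∣ h * s.val := by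
      rw [← ZMod.natCast_eq_zero_iff]
      push_cast
      rw [ZMod.natCast_val, ZMod.cast_id', id, hsum]
    obtain ⟨c, hc⟩ := hdvd
    have h2 : 2 ∣ s.val := ⟨c, Nat.eq_of_mul_eq_mul_left hh (by rw [hc]; ring)⟩
    rw [← (ZMod.natCast_eq_zero_iff s.val 2).mpr h2, ← map_natCast φ, ZMod.natCast_zmod_val]
  exact one_ne_zero (hφ.symm.trans hφ')

lemma prod_Iio_mul {k : ℕ} (p : Fin k → ℕ) (i : Fin k) :
    (∏ j ∈ Finset.Iio i, (p j : ℤ)) * p i = ∏ j ∈ Finset.Iic i, (p j : ℤ) := by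
  rw [← Finset.Iio_insert, Finset.prod_insert (by simp), mul_comm]

lemma not_hasWZSS_of_chain {k n : ℕ} (p : Fin k → ℕ) (hp : ∀ i, (p i).Prime)
    (hn : n = 2 * ∏ i, p i) (b : Fin k → ℤ) (hb : ∀ i, IsCoprime (b i) ((p i : ℤ)))
    {m : ℕ} (hm : Odd m) (hmn : m ≤ n) :
    ¬ HasWZSS (U n)
      ((List.ofFn fun i : Fin k =>
          (((∏ j ∈ Finset.Iio i, (p j : ℤ)) * b i : ℤ) : ZMod n)) ++
        (List.replicate m ((n / 2 : ℕ) : ZMod n) ++ List.replicate (n - m) (0 : ZMod n))) n := by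
  have hpos : 0 < ∏ i, p i := Finset.prod_pos fun i _ => (hp i).pos
  have hhalf : n / 2 = ∏ i, p i := by omega
  rintro ⟨-, T, hTS, hTlen, hT⟩
  obtain ⟨T₁, T₂, rfl, hT₁, hT₂⟩ := List.sublist_append_iff.mp hTS
  rw [List.ofFn_eq_map] at hT₁
  obtain ⟨I, hI, rfl⟩ := List.sublist_map_iff.mp hT₁
  match I with
  | [] =>
    have hT₂eq := hT₂.eq_of_length (by simp at hTlen ⊢; omega)
    rw [List.map_nil, List.nil_append, hT₂eq, hhalf] at hT
    subst hn
    exact not_isWZSum_replicate hpos hm hT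
  | i :: I =>
    have hsorted := List.pairwise_cons.mp ((List.pairwise_lt_finRange k).sublist hI)
    have hprodn : (∏ j ∈ Finset.Iic i, (p j : ℤ)) ∣ (∏ j, p j : ℕ) := by
      push_cast
      exact Finset.prod_dvd_prod_of_subset _ _ _ (Finset.subset_univ _)
    refine not_isWZSum_cons (g := ((∏ j ∈ Finset.Iic i, (p j : ℤ) : ℤ) : ZMod n)) ?_ ?_ hT
    · intro c hc
      rcases List.mem_append.mp hc with hc | hc
      · obtain ⟨j, hj, rfl⟩ := List.mem_map.mp hc
        refine map_dvd (Int.castRingHom (ZMod n)) (Dvd.dvd.mul_right ?_ _)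
        refine Finset.prod_dvd_prod_of_subset _ _ _ fun l hl => ?_
        exact Finset.mem_Iio.mpr ((Finset.mem_Iic.mp hl).trans_lt (hsorted.1 j hj))
      · rcases List.mem_append.mp (hT₂.subset hc) with hc | hc
        · rw [List.eq_of_mem_replicate hc, hhalf, ← Int.cast_natCast]
          exact map_dvd (Int.castRingHom (ZMod n)) hprodn
        · rw [List.eq_of_mem_replicate hc]
          exact dvd_zero _
    · rintro ⟨z, hz⟩
      obtain ⟨z, rfl⟩ := ZMod.intCast_surjective z
      rw [← Int.cast_mul, ZMod.intCast_eq_intCast_iff_dvd_sub] at hz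
      have hgn : (∏ j ∈ Finset.Iic i, (p j : ℤ)) ∣ (n : ℤ) := by
        rw [hn, Nat.cast_mul]
        exact hprodn.mul_left _
      have hdvd := (dvd_sub_right (Dvd.intro z rfl)).mp (hgn.trans hz)
      rw [← prod_Iio_mul] at hdvd
      have hne : (∏ j ∈ Finset.Iio i, (p j : ℤ)) ≠ 0 :=
        Finset.prod_ne_zero_iff.mpr fun j _ => by exact_mod_cast (hp j).ne_zero
      have hpb : (p i : ℤ) ∣ b i := (mul_dvd_mul_iff_left hne).mp hdvd
      exact (Nat.prime_iff_prime_int.mp (hp i)).not_isUnit ((hb i).isUnit_of_dvd' hpb dvd_rfl)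

lemma cardFactors_prod_of_prime {ι : Type*} (s : Finset ι) (p : ι → ℕ) (hp : ∀ i, (p i).Prime) :
    cardFactors (∏ i ∈ s, p i) = #s := by
  classical
  induction s using Finset.induction_on with
  | empty => simp
  | insert i s hi ih =>
    rw [Finset.prod_insert hi, Finset.card_insert_of_notMem hi,
      ArithmeticFunction.cardFactors_mul (hp i).ne_zero
        (Finset.prod_ne_zero_iff.mpr fun j _ => (hp j).ne_zero),
      ArithmeticFunction.cardFactors_apply_prime (hp i), ih, add_comm]

/-- If `n = 2 * p 1 * ... * p k` with the `p i` prime, `m ≤ n` odd and each `b i` coprime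
to `p i`, then `(b 1, p 1 * b 2, ..., p 1 * ... * p (k-1) * b k, n/2, ..., n/2, 0, ..., 0)`
(with `m` copies of `n / 2` and `n - m` zeroes; for `k = 1` this is
`(b 1, p, ..., p, 0, ..., 0)` since `n / 2 = p 1`) is a `U(n)`-extremal sequence for the
Gao constant. -/
theorem ast_is_gao_extremal (k n : ℕ) (hk : 1 ≤ k) (p : Fin k → ℕ)
    (hp : ∀ i, (p i).Prime) (hn : n = 2 * ∏ i, p i)
    (b : Fin k → ℤ) (hb : ∀ i, IsCoprime (b i) ((p i : ℤ)))
    (m : ℕ) (hm : Odd m) (hmn : m ≤ n) :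
    ((List.ofFn fun i : Fin k =>
        (((∏ j ∈ Finset.Iio i, (p j : ℤ)) * b i : ℤ) : ZMod n)) ++
      (List.replicate m ((n / 2 : ℕ) : ZMod n) ++ List.replicate (n - m) (0 : ZMod n))).length
        = n - 1 + (Nat.primeFactorsList n).length ∧
    IsGaoExtremal n (U n)
      ((List.ofFn fun i : Fin k =>
          (((∏ j ∈ Finset.Iio i, (p j : ℤ)) * b i : ℤ) : ZMod n)) ++
        (List.replicate m ((n / 2 : ℕ) : ZMod n) ++ List.replicate (n - m) (0 : ZMod n))) := by
  have hpos : 0 < ∏ i, p i := Finset.prod_pos fun i _ => (hp i).pos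
  have hn0 : 0 < n := by omega
  have hΩ : cardFactors n = k + 1 := by
    rw [hn, ArithmeticFunction.cardFactors_mul two_ne_zero hpos.ne',
      ArithmeticFunction.cardFactors_apply_prime Nat.prime_two,
      cardFactors_prod_of_prime _ p hp, Finset.card_fin, add_comm]
  have hnot := not_hasWZSS_of_chain p hp hn b hb hm hmn
  set S := (List.ofFn fun i : Fin k =>
      (((∏ j ∈ Finset.Iio i, (p j : ℤ)) * b i : ℤ) : ZMod n)) ++
    (List.replicate m ((n / 2 : ℕ) : ZMod n) ++ List.replicate (n - m) (0 : ZMod n)) with hS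
  have hlen : S.length = n + k := by
    simp only [hS, List.length_append, List.length_ofFn, List.length_replicate]
    omega
  have hGao : GaoC n (U n) = n + cardFactors n := by
    have hmem : n + cardFactors n ∈
        {k | 0 < k ∧ ∀ S : List (ZMod n), S.length = k → HasWZSS (U n) S n} :=
      ⟨by omega, hasWZSS_of_length_eq hn0 (Dvd.intro _ hn.symm)⟩
    refine le_antisymm (Nat.sInf_le hmem) (le_csInf ⟨_, hmem⟩ fun t ht => ?_)
    by_contra! hlt
    exact hnot ((ht.2 (S.take t) (by rw [List.length_take]; omega)).mono (List.take_sublist t S))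
  refine ⟨?_, ?_, hnot⟩
  · rw [← ArithmeticFunction.cardFactors_apply, hlen, hΩ]
    omega
  · rw [hlen, hGao, hΩ]
    omega
end
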